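/- arXiv:2209.10522 — 4 statements merged into one kernel-verified Lean document; each statement's English description precedes it below -/
import Mathlib

section
/- (Theorem 1) If ρ is a nonreal zero of the Riemann zeta function with 0 < Re(ρ) < 1, then Σ_{j=1}^∞ Σ_{d∣j} a(d) b(j/d) (j/d²)^{ρ/2} K(ρ, 2π√j) = 0, where the double series converges absolutely. -/
open scoped Real
open Real Complex MeasureTheory

noncomputable section

/-- `a(2^l * m) = 2^l * σ₁(m)` for `m` odd; in particular `a(n) = σ₁(n)` for odd `n`. -/
def paperA (n : ℕ) : ℤ :=
  2 ^ (n.factorization 2) * (ArithmeticFunction.sigma 1 (ordCompl[2] n) : ℤ)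

/-- `b(n) = σ₁(n)` for odd `n`, `b(n) = 0` for even `n`. -/
def paperB (n : ℕ) : ℤ :=
  if Odd n then (ArithmeticFunction.sigma 1 n : ℤ) else 0

/-- The modified Bessel function of the second kind,
`K(s, x) = (1/2) ∫_0^∞ u^{s−1} exp(−(x/2)(u + 1/u)) du`. -/
def besselK (s : ℂ) (x : ℝ) : ℂ :=
  (1 / 2) * ∫ u in Set.Ioi (0 : ℝ),
    (u : ℂ) ^ (s - 1) * Complex.exp (-((x : ℂ) / 2) * (u + 1 / u))

/-- The general term of the double series. -/
def seriesTerm (s : ℂ) (j d : ℕ) : ℂ :=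
  (paperA d : ℂ) * (paperB (j / d) : ℂ) * ((j : ℂ) / (d : ℂ) ^ 2) ^ (s / 2) *
    besselK s (2 * π * Real.sqrt j)

/-! ### Summing over simple integral binary quadratic forms

A triple `Q = (B, A, C)` stands for the form `A x² + B x y + C y²`; it is *simple* if
`C < 0 < A`. -/

/-- The discriminant of the form `(B, A, C)`. -/
def formDisc (Q : ℤ × ℤ × ℤ) : ℤ := Q.1 ^ 2 - 4 * Q.2.1 * Q.2.2

/-- The substitution `x ↦ x + y`. -/
def shiftX : ℤ × ℤ × ℤ ≃ ℤ × ℤ × ℤ where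
  toFun Q := (Q.1 + 2 * Q.2.1, Q.2.1, Q.2.1 + Q.1 + Q.2.2)
  invFun Q := (Q.1 - 2 * Q.2.1, Q.2.1, Q.2.1 - Q.1 + Q.2.2)
  left_inv := by rintro ⟨b, a, c⟩; ext <;> simp; ring
  right_inv := by rintro ⟨b, a, c⟩; ext <;> simp; ring

/-- The substitution `y ↦ x + y`. -/
def shiftY : ℤ × ℤ × ℤ ≃ ℤ × ℤ × ℤ where
  toFun Q := (Q.1 + 2 * Q.2.2, Q.2.1 + Q.1 + Q.2.2, Q.2.2)
  invFun Q := (Q.1 - 2 * Q.2.2, Q.2.1 - Q.1 + Q.2.2, Q.2.2)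
  left_inv := by rintro ⟨b, a, c⟩; ext <;> simp; ring
  right_inv := by rintro ⟨b, a, c⟩; ext <;> simp; ring

/-- The substitution `y ↦ -y`. -/
def flipMiddle : ℤ × ℤ × ℤ ≃ ℤ × ℤ × ℤ where
  toFun Q := (-Q.1, Q.2.1, Q.2.2)
  invFun Q := (-Q.1, Q.2.1, Q.2.2)
  left_inv := by rintro ⟨b, a, c⟩; simp
  right_inv := by rintro ⟨b, a, c⟩; simp

/-- Negating a form and exchanging its variables. -/
def swapOuter : ℤ × ℤ × ℤ ≃ ℤ × ℤ × ℤ where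
  toFun Q := (Q.1, -Q.2.2, -Q.2.1)
  invFun Q := (Q.1, -Q.2.2, -Q.2.1)
  left_inv := by rintro ⟨b, a, c⟩; simp
  right_inv := by rintro ⟨b, a, c⟩; simp

/-- Restriction of a function to the simple forms. -/
def onSimple (f : ℤ × ℤ × ℤ → ℝ) (Q : ℤ × ℤ × ℤ) : ℝ :=
  if 0 < Q.2.1 ∧ Q.2.2 < 0 then f Q else 0

/-- The value of `f` after one step of the reduction algorithm on simple forms. -/
def stepForm (f : ℤ × ℤ × ℤ → ℝ) (Q : ℤ × ℤ × ℤ) : ℝ :=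
  if Q.2.1 + Q.1 + Q.2.2 < 0 then f (shiftX Q)
  else if 0 < Q.2.1 + Q.1 + Q.2.2 then f (shiftY Q) else 0

lemma formDisc_shiftX (Q : ℤ × ℤ × ℤ) : formDisc (shiftX Q) = formDisc Q := by
  simp only [formDisc, shiftX, Equiv.coe_fn_mk]; ring

lemma formDisc_shiftY (Q : ℤ × ℤ × ℤ) : formDisc (shiftY Q) = formDisc Q := by
  simp only [formDisc, shiftY, Equiv.coe_fn_mk]; ring

lemma formDisc_flipMiddle (Q : ℤ × ℤ × ℤ) : formDisc (flipMiddle Q) = formDisc Q := by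
  simp only [formDisc, flipMiddle, Equiv.coe_fn_mk]; ring

lemma formDisc_swapOuter (Q : ℤ × ℤ × ℤ) : formDisc (swapOuter Q) = formDisc Q := by
  simp only [formDisc, swapOuter, Equiv.coe_fn_mk]; ring

lemma onSimple_comp_flipMiddle (f : ℤ × ℤ × ℤ → ℝ) (Q : ℤ × ℤ × ℤ) :
    onSimple f (flipMiddle Q) = onSimple (fun Q => f (flipMiddle Q)) Q := rfl

lemma onSimple_comp_swapOuter (f : ℤ × ℤ × ℤ → ℝ) (Q : ℤ × ℤ × ℤ) :
    onSimple f (swapOuter Q) = onSimple (fun Q => f (swapOuter Q)) Q := by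
  simp only [onSimple]
  congr 1
  simp only [swapOuter, Equiv.coe_fn_mk, eq_iff_iff]
  omega

/-- Reduction permutes the simple forms with `A + B + C ≠ 0` and those with `A - B + C ≠ 0`. -/
theorem tsum_onSimple_stepForm {f : ℤ × ℤ × ℤ → ℝ} (hf : Summable (onSimple f)) :
    Summable (onSimple (stepForm f)) ∧
    ∑' Q, onSimple (stepForm f) Q =
      ∑' Q, onSimple f Q -
        ∑' Q : ℤ × ℤ × ℤ, if Q.2.1 - Q.1 + Q.2.2 = 0 then onSimple f Q else 0 := by
  have hrestrict (p : ℤ × ℤ × ℤ → Prop) [DecidablePred p] :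
      Summable (fun Q => if p Q then onSimple f Q else 0) := by
    refine (hf.indicator {Q | p Q}).congr fun Q => ?_
    simp only [Set.indicator, Set.mem_ofPred_eq]
    split_ifs <;> rfl
  set g₁ : ℤ × ℤ × ℤ → ℝ := fun Q => if Q.2.1 - Q.1 + Q.2.2 < 0 then onSimple f Q else 0
  set g₂ : ℤ × ℤ × ℤ → ℝ := fun Q => if 0 < Q.2.1 - Q.1 + Q.2.2 then onSimple f Q else 0
  set g₀ : ℤ × ℤ × ℤ → ℝ := fun Q => if Q.2.1 - Q.1 + Q.2.2 = 0 then onSimple f Q else 0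
  have h₁ : Summable g₁ := hrestrict _
  have h₂ : Summable g₂ := hrestrict _
  have h₀ : Summable g₀ := hrestrict _
  have hstep (Q) : onSimple (stepForm f) Q = g₁ (shiftX Q) + g₂ (shiftY Q) := by
    obtain ⟨b, a, c⟩ := Q
    simp only [onSimple, stepForm, g₁, g₂, shiftX, shiftY, Equiv.coe_fn_mk]
    split_ifs <;> first | omega | simp
  have hsplit (Q) : onSimple f Q = g₁ Q + g₂ Q + g₀ Q := by
    simp only [g₁, g₂, g₀]
    split_ifs <;> first | omega | simp
  have k₁ := shiftX.summable_iff.2 h₁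
  have k₂ := shiftY.summable_iff.2 h₂
  refine ⟨(k₁.add k₂).congr fun Q => (hstep Q).symm, ?_⟩
  rw [tsum_congr hstep, tsum_congr hsplit, (h₁.add h₂).tsum_add h₀, h₁.tsum_add h₂,
    Summable.tsum_add (f := fun Q => g₁ (shiftX Q)) (g := fun Q => g₂ (shiftY Q)) k₁ k₂,
    shiftX.tsum_eq g₁, shiftY.tsum_eq g₂]
  ring

lemma tsum_onSimple_eq_zero_of_flip {f : ℤ × ℤ × ℤ → ℝ} (hf : ∀ Q, f (flipMiddle Q) = -f Q) :
    ∑' Q, onSimple f Q = 0 := by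
  have h := flipMiddle.tsum_eq (onSimple f)
  have h' (Q) : onSimple f (flipMiddle Q) = -onSimple f Q := by
    rw [onSimple_comp_flipMiddle]
    simp only [onSimple, hf]
    split_ifs <;> simp
  rw [tsum_congr h', tsum_neg] at h
  linarith

lemma tsum_onSimple_eq_zero_of_swap {f : ℤ × ℤ × ℤ → ℝ} (hf : ∀ Q, f (swapOuter Q) = -f Q) :
    ∑' Q, onSimple f Q = 0 := by
  have h := swapOuter.tsum_eq (onSimple f)
  have h' (Q) : onSimple f (swapOuter Q) = -onSimple f Q := by
    rw [onSimple_comp_swapOuter]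
    simp only [onSimple, hf]
    split_ifs <;> simp
  rw [tsum_congr h', tsum_neg] at h
  linarith

/-- If every monomial weighted by `ω (disc)` is summable, then the simple forms with all
coefficients odd satisfy this cubic relation. -/
theorem tsum_odd_simple_forms {ω : ℤ → ℝ}
    (hω : ∀ i j k : ℕ, Summable
      (onSimple fun Q => (Q.2.1 : ℝ) ^ i * Q.1 ^ j * Q.2.2 ^ k * ω (formDisc Q))) :
    ∑' Q, onSimple (fun Q => if Odd Q.2.1 ∧ Odd Q.1 ∧ Odd Q.2.2 then
      ((Q.1 : ℝ) ^ 2 + Q.2.1 * Q.2.2) * Q.2.1 * ω (formDisc Q) else 0) Q = 0 := by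
  classical
  set χ : ℤ × ℤ × ℤ → Prop := fun Q => Odd Q.2.1 ∧ Odd Q.1 ∧ Odd Q.2.2
  have hmono (i j k : ℕ) : Summable (onSimple fun Q => if χ Q then
      (Q.2.1 : ℝ) ^ i * Q.1 ^ j * Q.2.2 ^ k * ω (formDisc Q) else 0) := by
    refine ((hω i j k).indicator {Q | χ Q}).congr fun Q => ?_
    simp only [Set.indicator, onSimple, Set.mem_ofPred_eq]
    split_ifs <;> rfl
  set f : ℤ × ℤ × ℤ → ℝ := fun Q => if χ Q then
    (-(1 / 2) * (Q.1 * Q.2.2 ^ 2) + Q.1 ^ 2 * Q.2.2 - 1 / 4 * Q.1 ^ 3 + Q.2.1 * Q.2.2 ^ 2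
      - 3 / 2 * (Q.2.1 * Q.1 * Q.2.2) + 1 / 2 * (Q.2.1 ^ 2 * Q.1)) * ω (formDisc Q) else 0
  have hf : Summable (onSimple f) := by
    refine ((((((hmono 0 1 2).mul_left (-(1 / 2))).add (hmono 0 2 1)).add
      ((hmono 0 3 0).mul_left (-(1 / 4)))).add (hmono 1 0 2)).add
      (((hmono 1 1 1).mul_left (-(3 / 2))).add ((hmono 2 1 0).mul_left (1 / 2)))).congr
      fun Q => ?_
    simp only [onSimple, f]
    split_ifs
    · ring
    · simp
    · simp
  set h : ℤ × ℤ × ℤ → ℝ := fun Q => if χ Q then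
    (-(1 / 2) * Q.1 ^ 3 - 3 * (Q.2.1 * Q.1 * Q.2.2)) * ω (formDisc Q) else 0
  have hh : Summable (onSimple h) := by
    refine (((hmono 0 3 0).mul_left (-(1 / 2))).add ((hmono 1 1 1).mul_left (-3))).congr
      fun Q => ?_
    simp only [onSimple, h]
    split_ifs
    · ring
    · simp
    · simp
  have hχX (Q) : χ (shiftX Q) ↔ χ Q := by
    simp only [χ, shiftX, Equiv.coe_fn_mk, Int.odd_iff]; omega
  have hχY (Q) : χ (shiftY Q) ↔ χ Q := by
    simp only [χ, shiftY, Equiv.coe_fn_mk, Int.odd_iff]; omega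
  have hχf (Q) : χ (flipMiddle Q) ↔ χ Q := by
    simp only [χ, flipMiddle, Equiv.coe_fn_mk, Int.odd_iff]; omega
  have hχs (Q) : χ (swapOuter Q) ↔ χ Q := by
    simp only [χ, swapOuter, Equiv.coe_fn_mk, Int.odd_iff]; omega
  set p : ℤ × ℤ × ℤ → ℝ := fun Q => if χ Q then
    ((Q.1 : ℝ) ^ 2 + Q.2.1 * Q.2.2) * (Q.2.1 - Q.2.2) * ω (formDisc Q) else 0
  have hstep (Q) : onSimple p Q = onSimple (stepForm f) Q - onSimple f Q + onSimple h Q := by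
    by_cases hs : 0 < Q.2.1 ∧ Q.2.2 < 0
    · by_cases hQ : χ Q
      · have hne : Q.2.1 + Q.1 + Q.2.2 ≠ 0 := by
          simp only [χ, Int.odd_iff] at hQ; omega
        simp only [onSimple, if_pos hs, stepForm, f, h, p, hχX, hχY, formDisc_shiftX,
          formDisc_shiftY, if_pos hQ]
        rcases hne.lt_or_gt with hlt | hgt
        · simp only [if_pos hlt, shiftX, Equiv.coe_fn_mk]; push_cast; ring
        · simp only [if_neg hgt.not_gt, if_pos hgt, shiftY, Equiv.coe_fn_mk]; push_cast; ring
      · simp [onSimple, stepForm, f, h, p, hχX, hχY, hQ]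
    · simp [onSimple, hs]
  have hp : ∑' Q, onSimple p Q = 0 := by
    obtain ⟨hs, ht⟩ := tsum_onSimple_stepForm hf
    rw [tsum_congr hstep, (hs.sub hf).tsum_add hh, hs.tsum_sub hf, ht]
    have h0 : ∑' Q, onSimple h Q = 0 := tsum_onSimple_eq_zero_of_flip fun Q => by
      simp only [h, hχf, formDisc_flipMiddle]
      split_ifs
      · simp only [flipMiddle, Equiv.coe_fn_mk]; push_cast; ring
      · simp
    have h1 : ∑' Q : ℤ × ℤ × ℤ, (if Q.2.1 - Q.1 + Q.2.2 = 0 then onSimple f Q else 0) = 0 := by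
      refine (tsum_congr fun Q => ?_).trans tsum_zero
      simp only [onSimple, f]
      by_cases hQ : χ Q
      · have hne : Q.2.1 - Q.1 + Q.2.2 ≠ 0 := by
          simp only [χ, Int.odd_iff] at hQ; omega
        rw [if_neg hne]
      · simp [hQ]
    rw [h0, h1]; ring
  set q : ℤ × ℤ × ℤ → ℝ := fun Q => if χ Q then
    ((Q.1 : ℝ) ^ 2 + Q.2.1 * Q.2.2) * (Q.2.1 + Q.2.2) * ω (formDisc Q) else 0
  have hq : ∑' Q, onSimple q Q = 0 := tsum_onSimple_eq_zero_of_swap fun Q => by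
    simp only [q, hχs, formDisc_swapOuter]
    split_ifs
    · simp only [swapOuter, Equiv.coe_fn_mk]; push_cast; ring
    · simp
  have hsA : Summable (onSimple fun Q => if χ Q then
      ((Q.1 : ℝ) ^ 2 + Q.2.1 * Q.2.2) * Q.2.1 * ω (formDisc Q) else 0) := by
    refine ((hmono 1 2 0).add (hmono 2 0 1)).congr fun Q => ?_
    simp only [onSimple]
    split_ifs
    · ring
    · simp
    · simp
  have hsC : Summable (onSimple fun Q => if χ Q then
      ((Q.1 : ℝ) ^ 2 + Q.2.1 * Q.2.2) * Q.2.2 * ω (formDisc Q) else 0) := by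
    refine ((hmono 0 2 1).add (hmono 1 0 2)).congr fun Q => ?_
    simp only [onSimple]
    split_ifs
    · ring
    · simp
    · simp
  have e1 : ∑' Q, onSimple p Q = (∑' Q, onSimple (fun Q => if χ Q then
      ((Q.1 : ℝ) ^ 2 + Q.2.1 * Q.2.2) * Q.2.1 * ω (formDisc Q) else 0) Q) -
      ∑' Q, onSimple (fun Q => if χ Q then
      ((Q.1 : ℝ) ^ 2 + Q.2.1 * Q.2.2) * Q.2.2 * ω (formDisc Q) else 0) Q := by
    rw [← hsA.tsum_sub hsC]
    refine tsum_congr fun Q => ?_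
    simp only [onSimple, p]
    split_ifs
    · ring
    · simp
    · simp
  have e2 : ∑' Q, onSimple q Q = (∑' Q, onSimple (fun Q => if χ Q then
      ((Q.1 : ℝ) ^ 2 + Q.2.1 * Q.2.2) * Q.2.1 * ω (formDisc Q) else 0) Q) +
      ∑' Q, onSimple (fun Q => if χ Q then
      ((Q.1 : ℝ) ^ 2 + Q.2.1 * Q.2.2) * Q.2.2 * ω (formDisc Q) else 0) Q := by
    rw [← hsA.tsum_add hsC]
    refine tsum_congr fun Q => ?_
    simp only [onSimple, q]
    split_ifs
    · ring
    · simp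
    · simp
  linarith

set_option maxHeartbeats 1600000 in
/-- The linear relation for simple forms with even middle coefficient; the square discriminants
contribute the right hand side. -/
theorem tsum_even_simple_forms {ω : ℤ → ℝ}
    (hω : ∀ i j k : ℕ, Summable
      (onSimple fun Q => (Q.2.1 : ℝ) ^ i * Q.1 ^ j * Q.2.2 ^ k * ω (formDisc Q))) :
    ∑' Q, onSimple (fun Q => if Even Q.1 ∧ Odd Q.2.1 then
      (if Even Q.2.2 then -(Q.2.2 : ℝ) else Q.2.2) * ω (formDisc Q) else 0) Q =
    -(1 / 2) * ∑' Q, onSimple (fun Q => if Odd Q.2.1 ∧ Odd Q.2.2 ∧ Q.2.1 - Q.1 + Q.2.2 = 0 then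
      ((Q.2.1 : ℝ) - Q.2.2) * ω (formDisc Q) else 0) Q := by
  classical
  have hmono (χ : ℤ × ℤ × ℤ → Prop) (i j k : ℕ) : Summable (onSimple fun Q => if χ Q then
      (Q.2.1 : ℝ) ^ i * Q.1 ^ j * Q.2.2 ^ k * ω (formDisc Q) else 0) := by
    refine ((hω i j k).indicator {Q | χ Q}).congr fun Q => ?_
    simp only [Set.indicator, onSimple, Set.mem_ofPred_eq]
    split_ifs <;> rfl
  have hlin (χ : ℤ × ℤ × ℤ → Prop) (x y z : ℝ) : Summable (onSimple fun Q => if χ Q then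
      (x * Q.2.1 + y * Q.1 + z * Q.2.2) * ω (formDisc Q) else 0) := by
    refine (((hmono χ 1 0 0).mul_left x).add (((hmono χ 0 1 0).mul_left y).add
      ((hmono χ 0 0 1).mul_left z))).congr fun Q => ?_
    simp only [onSimple]
    split_ifs
    · ring
    · simp
    · simp
  set oo : ℤ × ℤ × ℤ → Prop := fun Q => Even Q.1 ∧ Odd Q.2.1 ∧ Odd Q.2.2
  set oe : ℤ × ℤ × ℤ → Prop := fun Q => Even Q.1 ∧ Odd Q.2.1 ∧ Even Q.2.2
  set eo : ℤ × ℤ × ℤ → Prop := fun Q => Even Q.1 ∧ Even Q.2.1 ∧ Odd Q.2.2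
  let lin (χ : ℤ × ℤ × ℤ → Prop) (x y z : ℝ) : ℤ × ℤ × ℤ → ℝ := fun Q => if χ Q then
      (x * Q.2.1 + y * Q.1 + z * Q.2.2) * ω (formDisc Q) else 0
  have hlin' (χ x y z) : Summable (onSimple (lin χ x y z)) := hlin χ x y z
  have hadd (f g : ℤ × ℤ × ℤ → ℝ) : onSimple (f + g) = onSimple f + onSimple g := by
    ext Q; simp only [onSimple, Pi.add_apply]; split_ifs <;> simp
  set f : ℤ × ℤ × ℤ → ℝ :=
    lin oo (1 / 2) (-(1 / 4)) 0 + lin oe 0 (-(1 / 4)) (1 / 2) + lin eo 0 (1 / 4) 0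
  set h₁ : ℤ × ℤ × ℤ → ℝ := lin oo 0 (-(1 / 2)) 0
  set h₂ : ℤ × ℤ × ℤ → ℝ :=
    lin oo (1 / 2) 0 (1 / 2) + lin oe 0 0 (-(1 / 2)) + lin eo (-(1 / 2)) 0 0
  have hf : Summable (onSimple f) := by
    rw [hadd, hadd]; exact ((hlin' _ _ _ _).add (hlin' _ _ _ _)).add (hlin' _ _ _ _)
  have hh₁ : Summable (onSimple h₁) := hlin' _ _ _ _
  have hh₂ : Summable (onSimple h₂) := by
    rw [hadd, hadd]; exact ((hlin' _ _ _ _).add (hlin' _ _ _ _)).add (hlin' _ _ _ _)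
  have z₁ : ∑' Q, onSimple h₁ Q = 0 := tsum_onSimple_eq_zero_of_flip fun Q => by
    simp only [h₁, lin, formDisc_flipMiddle]
    have : oo (flipMiddle Q) ↔ oo Q := by
      simp only [oo, flipMiddle, Equiv.coe_fn_mk, Int.odd_iff, Int.even_iff]; omega
    simp only [this]
    split_ifs
    · simp only [flipMiddle, Equiv.coe_fn_mk]; push_cast; ring
    · simp
  have z₂ : ∑' Q, onSimple h₂ Q = 0 := tsum_onSimple_eq_zero_of_swap fun Q => by
    simp only [h₂, lin, formDisc_swapOuter, Pi.add_apply]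
    have e1 : oo (swapOuter Q) ↔ oo Q := by
      simp only [oo, swapOuter, Equiv.coe_fn_mk, Int.odd_iff, Int.even_iff]; omega
    have e2 : oe (swapOuter Q) ↔ eo Q := by
      simp only [oe, eo, swapOuter, Equiv.coe_fn_mk, Int.odd_iff, Int.even_iff]; omega
    have e3 : eo (swapOuter Q) ↔ oe Q := by
      simp only [oe, eo, swapOuter, Equiv.coe_fn_mk, Int.odd_iff, Int.even_iff]; omega
    simp only [e1, e2, e3]
    simp only [swapOuter, Equiv.coe_fn_mk]; push_cast
    split_ifs <;> ring
  set r : ℤ × ℤ × ℤ → ℝ := fun Q => if Odd Q.2.1 ∧ Odd Q.2.2 ∧ Q.2.1 - Q.1 + Q.2.2 = 0 then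
      ((Q.2.1 : ℝ) - Q.2.2) * ω (formDisc Q) else 0
  have hr : Summable (onSimple r) :=
    (hlin (fun Q => Odd Q.2.1 ∧ Odd Q.2.2 ∧ Q.2.1 - Q.1 + Q.2.2 = 0) 1 0 (-1)).congr
      fun Q => by simp only [onSimple, r]; split_ifs <;> ring
  have hr' : Summable (fun Q => onSimple r (flipMiddle Q)) := flipMiddle.summable_iff.2 hr
  have ooX (Q) : oo (shiftX Q) ↔ oe Q := by
    simp only [oo, oe, shiftX, Equiv.coe_fn_mk, Int.odd_iff, Int.even_iff]; omega
  have oeX (Q) : oe (shiftX Q) ↔ oo Q := by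
    simp only [oo, oe, shiftX, Equiv.coe_fn_mk, Int.odd_iff, Int.even_iff]; omega
  have eoX (Q) : eo (shiftX Q) ↔ eo Q := by
    simp only [eo, shiftX, Equiv.coe_fn_mk, Int.odd_iff, Int.even_iff]; omega
  have ooY (Q) : oo (shiftY Q) ↔ eo Q := by
    simp only [oo, eo, shiftY, Equiv.coe_fn_mk, Int.odd_iff, Int.even_iff]; omega
  have oeY (Q) : oe (shiftY Q) ↔ oe Q := by
    simp only [oe, shiftY, Equiv.coe_fn_mk, Int.odd_iff, Int.even_iff]; omega
  have eoY (Q) : eo (shiftY Q) ↔ oo Q := by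
    simp only [oo, eo, shiftY, Equiv.coe_fn_mk, Int.odd_iff, Int.even_iff]; omega
  have hpt (Q) : onSimple (fun Q => if Even Q.1 ∧ Odd Q.2.1 then
      (if Even Q.2.2 then -(Q.2.2 : ℝ) else Q.2.2) * ω (formDisc Q) else 0) Q =
      onSimple (stepForm f) Q - onSimple f Q + onSimple h₁ Q + onSimple h₂ Q -
        1 / 4 * onSimple r (flipMiddle Q) := by
    rw [onSimple_comp_flipMiddle]
    obtain ⟨b, a, c⟩ := Q
    by_cases hs : 0 < a ∧ c < 0
    swap
    · simp [onSimple, hs]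
    simp only [onSimple, if_pos hs, stepForm, f, h₁, h₂, lin, r, Pi.add_apply, formDisc_shiftX,
      formDisc_shiftY, formDisc_flipMiddle, ooX, ooY, oeX, oeY, eoX, eoY]
    have hooI : oo (b, a, c) ↔ Even b ∧ Odd a ∧ Odd c := Iff.rfl
    have hoeI : oe (b, a, c) ↔ Even b ∧ Odd a ∧ Even c := Iff.rfl
    have heoI : eo (b, a, c) ↔ Even b ∧ Even a ∧ Odd c := Iff.rfl
    simp only [shiftX, shiftY, flipMiddle, Equiv.coe_fn_mk]
    generalize ω (formDisc (b, a, c)) = w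
    simp only [Int.odd_iff, Int.even_iff] at hooI hoeI heoI ⊢
    rcases lt_trichotomy (a + b + c) 0 with hlt | heq | hgt
    · have hne : ¬(a % 2 = 1 ∧ c % 2 = 1 ∧ a - -b + c = 0) := by omega
      simp only [if_pos hlt, if_neg hne]
      by_cases h1 : oo (b, a, c)
      · have h2 : ¬oe (b, a, c) := by grind
        have h3 : ¬eo (b, a, c) := by grind
        have h4 : b % 2 = 0 ∧ a % 2 = 1 := by grind
        have h5 : ¬c % 2 = 0 := by grind
        simp only [if_pos h1, if_neg h2, if_neg h3, if_pos h4, if_neg h5]; push_cast; ring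
      by_cases h2 : oe (b, a, c)
      · have h3 : ¬eo (b, a, c) := by grind
        have h4 : b % 2 = 0 ∧ a % 2 = 1 := by grind
        have h5 : c % 2 = 0 := by grind
        simp only [if_neg h1, if_pos h2, if_neg h3, if_pos h4, if_pos h5]; push_cast; ring
      have h4 : ¬(b % 2 = 0 ∧ a % 2 = 1) := by grind
      simp only [if_neg h1, if_neg h2, if_neg h4]
      split_ifs <;> push_cast <;> ring
    · have hbc : (b : ℝ) = -a - c := by
        have : b = -a - c := by omega
        rw [this]; push_cast; ring
      simp only [heq, lt_irrefl, if_false]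
      by_cases h1 : oo (b, a, c)
      · have h2 : ¬oe (b, a, c) := by grind
        have h3 : ¬eo (b, a, c) := by grind
        have h4 : b % 2 = 0 ∧ a % 2 = 1 := by grind
        have h5 : ¬c % 2 = 0 := by grind
        have h6 : a % 2 = 1 ∧ c % 2 = 1 ∧ a - -b + c = 0 := by grind
        simp only [if_pos h1, if_neg h2, if_neg h3, if_pos h4, if_neg h5, if_pos h6, hbc]
        ring
      have h2 : ¬oe (b, a, c) := by intro h; have := hoeI.1 h; omega
      have h3 : ¬eo (b, a, c) := by intro h; have := heoI.1 h; omega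
      have h4 : ¬(b % 2 = 0 ∧ a % 2 = 1) := by
        intro h; exact h1 (hooI.2 (by omega))
      have h6 : ¬(a % 2 = 1 ∧ c % 2 = 1 ∧ a - -b + c = 0) := by
        intro h; exact h1 (hooI.2 (by omega))
      simp only [if_neg h1, if_neg h2, if_neg h3, if_neg h4, if_neg h6]
      ring
    · have hne : ¬(a % 2 = 1 ∧ c % 2 = 1 ∧ a - -b + c = 0) := by omega
      simp only [if_neg hgt.not_gt, if_pos hgt, if_neg hne]
      by_cases h1 : oo (b, a, c)
      · have h2 : ¬oe (b, a, c) := by grind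
        have h3 : ¬eo (b, a, c) := by grind
        have h4 : b % 2 = 0 ∧ a % 2 = 1 := by grind
        have h5 : ¬c % 2 = 0 := by grind
        simp only [if_pos h1, if_neg h2, if_neg h3, if_pos h4, if_neg h5]; push_cast; ring
      by_cases h2 : oe (b, a, c)
      · have h3 : ¬eo (b, a, c) := by grind
        have h4 : b % 2 = 0 ∧ a % 2 = 1 := by grind
        have h5 : c % 2 = 0 := by grind
        simp only [if_neg h1, if_pos h2, if_neg h3, if_pos h4, if_pos h5]; push_cast; ring
      have h4 : ¬(b % 2 = 0 ∧ a % 2 = 1) := by grind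
      simp only [if_neg h1, if_neg h2, if_neg h4]
      split_ifs <;> push_cast <;> ring
  obtain ⟨hs, ht⟩ := tsum_onSimple_stepForm hf
  have hb : ∑' Q : ℤ × ℤ × ℤ, (if Q.2.1 - Q.1 + Q.2.2 = 0 then onSimple f Q else 0) =
      1 / 4 * ∑' Q, onSimple r Q := by
    rw [← tsum_mul_left]
    refine tsum_congr fun Q => ?_
    obtain ⟨b, a, c⟩ := Q
    by_cases h0 : a - b + c = 0
    · have hbc : (b : ℝ) = a + c := by
        have : b = a + c := by omega
        rw [this]; push_cast; ring
      have h2 : ¬oe (b, a, c) := by simp only [oe, Int.odd_iff, Int.even_iff]; omega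
      have h3 : ¬eo (b, a, c) := by simp only [eo, Int.odd_iff, Int.even_iff]; omega
      have h4 : Odd a ∧ Odd c ∧ a - b + c = 0 ↔ oo (b, a, c) := by
        simp only [oo, Int.odd_iff, Int.even_iff]; omega
      simp only [onSimple, f, lin, r, Pi.add_apply, if_neg h2, if_neg h3, h4, if_pos h0, hbc]
      split_ifs <;> ring
    · simp [h0, onSimple, r]
  rw [tsum_congr hpt, (((hs.sub hf).add hh₁).add hh₂).tsum_sub (hr'.mul_left _),
    ((hs.sub hf).add hh₁).tsum_add hh₂, (hs.sub hf).tsum_add hh₁, hs.tsum_sub hf, ht, z₁, z₂, hb,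
    tsum_mul_left, flipMiddle.tsum_eq (onSimple r)]
  ring

/-- The exponential series `∑ aᵢ exp(-π pᵢ y)`. -/
def expSeries {ι : Type*} (a p : ι → ℝ) (y : ℝ) : ℝ := ∑' i, a i * rexp (-π * p i * y)

/-- The series `∑ |aᵢ| exp(-π pᵢ y)` has nonnegative frequencies and converges for all `y > 0`. -/
structure IsExpSummable {ι : Type*} (a p : ι → ℝ) : Prop where
  nonneg : ∀ i, 0 ≤ p i
  summable : ∀ y, 0 < y → Summable fun i => |a i| * rexp (-π * p i * y)

namespace IsExpSummable

variable {ι : Type*} {a p : ι → ℝ}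

lemma hasSum (h : IsExpSummable a p) {y : ℝ} (hy : 0 < y) :
    HasSum (fun i => a i * rexp (-π * p i * y)) (expSeries a p y) := by
  refine Summable.hasSum (Summable.of_norm ?_)
  simpa [abs_mul, abs_of_pos (Real.exp_pos _)] using h.summable y hy

lemma summable_norm (h : IsExpSummable a p) {y : ℝ} (hy : 0 < y) :
    Summable (fun i => ‖a i * rexp (-π * p i * y)‖) := by
  simpa [abs_mul, abs_of_pos (Real.exp_pos _)] using h.summable y hy

lemma mul_frequency (h : IsExpSummable a p) : IsExpSummable (fun i => a i * p i) p := by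
  refine ⟨h.nonneg, fun y hy => ?_⟩
  have hc : 0 < π * y / 2 := by positivity
  refine Summable.of_nonneg_of_le (fun i => by positivity) (fun i => ?_)
    ((h.summable (y / 2) (by positivity)).mul_left (1 / (π * y / 2)))
  have h1 : π * y / 2 * p i ≤ rexp (π * y / 2 * p i) :=
    (by linarith : π * y / 2 * p i ≤ π * y / 2 * p i + 1).trans (Real.add_one_le_exp _)
  have h2 : p i ≤ 1 / (π * y / 2) * rexp (π * y / 2 * p i) := by
    rw [one_div, ← div_eq_inv_mul, le_div_iff₀ hc]; linarith
  have h3 : rexp (-π * p i * (y / 2)) = rexp (π * y / 2 * p i) * rexp (-π * p i * y) := by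
    rw [← Real.exp_add]; ring_nf
  rw [abs_mul, abs_of_nonneg (h.nonneg i), h3]
  calc |a i| * p i * rexp (-π * p i * y)
      ≤ |a i| * (1 / (π * y / 2) * rexp (π * y / 2 * p i)) * rexp (-π * p i * y) := by gcongr
    _ = _ := by ring

lemma hasDerivAt (h : IsExpSummable a p) {y : ℝ} (hy : 0 < y) :
    HasDerivAt (expSeries a p) (-π * expSeries (fun i => a i * p i) p y) y := by
  have key := hasDerivAt_tsum_of_isPreconnected
    (g := fun i z => a i * rexp (-π * p i * z))
    (g' := fun i z => a i * (rexp (-π * p i * z) * (-π * p i)))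
    (u := fun i => π * (|a i * p i| * rexp (-π * p i * (y / 2)))) (t := Set.Ioi (y / 2))
    (y₀ := y) (y := y) ((h.mul_frequency.summable (y / 2) (by positivity)).mul_left π) isOpen_Ioi
    isPreconnected_Ioi (fun i z _ => ?_) (fun i z hz => ?_) (by simpa using hy)
    (h.hasSum hy).summable (by simpa using hy)
  · convert! key using 1
    rw [expSeries, ← tsum_mul_left]
    exact tsum_congr fun i => by ring
  · refine ((HasDerivAt.exp ?_)).const_mul (a i)
    exact hasDerivAt_const_mul (-π * p i)
  · have hp := h.nonneg i
    have h1 : rexp (-π * p i * z) ≤ rexp (-π * p i * (y / 2)) := by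
      apply Real.exp_le_exp.2
      have : π * p i * (y / 2) ≤ π * p i * z := by
        have := (Set.mem_Ioi.1 hz).le
        gcongr
      linarith
    have h2 : ‖a i * (rexp (-π * p i * z) * (-π * p i))‖
        = π * (|a i * p i| * rexp (-π * p i * z)) := by
      simp only [norm_mul, Real.norm_eq_abs, abs_neg, abs_mul, Real.abs_exp, abs_of_pos Real.pi_pos]
      ring
    rw [h2]
    gcongr

lemma continuousOn (h : IsExpSummable a p) : ContinuousOn (expSeries a p) (Set.Ioi 0) :=
  fun _ hy => (h.hasDerivAt hy).continuousAt.continuousWithinAt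

end IsExpSummable

lemma summable_int_pow_mul_exp (k : ℕ) {c : ℝ} (hc : 0 < c) :
    Summable fun n : ℤ => |(n : ℝ)| ^ k * rexp (-c * |(n : ℝ)|) := by
  refine Summable.of_nat_of_neg ?_ ?_ <;>
  · simpa using Real.summable_pow_mul_exp_neg_nat_mul k hc

lemma add_le_two_mul_mul {x y : ℝ} (hx : 1 ≤ x) (hy : 1 ≤ y) : x + y ≤ 2 * (x * y) := by
  nlinarith [mul_nonneg (sub_nonneg.2 hx) (sub_nonneg.2 hy)]

lemma abs_intCast_le_sq (n : ℤ) : |(n : ℝ)| ≤ (n : ℝ) ^ 2 := by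
  rw [← sq_abs]
  have : |n| ≤ |n| ^ 2 := by
    rcases eq_or_ne n 0 with rfl | h
    · simp
    · have := Int.one_le_abs h
      nlinarith
  exact_mod_cast this

lemma summable_int_exp_sq {a : ℤ → ℝ} (ha : ∀ n, |a n| ≤ 1) {r : ℝ} (hr : 0 < r) :
    IsExpSummable a fun n : ℤ => r * (n : ℝ) ^ 2 := by
  refine ⟨fun n => by positivity, fun y hy => ?_⟩
  refine Summable.of_nonneg_of_le (fun i => by positivity) (fun n => ?_)
    (summable_int_pow_mul_exp 0 (c := π * r * y) (by positivity))
  rw [pow_zero]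
  refine mul_le_mul (ha n) (Real.exp_le_exp.2 ?_) (Real.exp_pos _).le zero_le_one
  have := mul_le_mul_of_nonneg_left (abs_intCast_le_sq n) (by positivity : 0 ≤ π * r * y)
  linarith

lemma summable_lambert {a : ℕ × ℕ → ℝ}
    (ha : ∀ q, |a q| ≤ if 0 < q.1 ∧ 0 < q.2 then (q.1 : ℝ) else 0) :
    IsExpSummable a fun q : ℕ × ℕ => (q.1 : ℝ) * q.2 := by
  refine ⟨fun n => by positivity, fun y hy => ?_⟩
  have hc : 0 < π * y / 2 := by positivity
  have hs := Summable.mul_of_nonneg (Real.summable_pow_mul_exp_neg_nat_mul 1 hc)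
    (Real.summable_pow_mul_exp_neg_nat_mul 0 hc) (fun n => by positivity) (fun n => by positivity)
  refine Summable.of_nonneg_of_le (fun i => by positivity) (fun q => ?_) hs
  have hq := ha q
  split_ifs at hq with h
  · have h1 : (1 : ℝ) ≤ q.1 := by exact_mod_cast h.1
    have h2 : (1 : ℝ) ≤ q.2 := by exact_mod_cast h.2
    have h3 : rexp (-π * (q.1 * q.2) * y) ≤
        rexp (-(π * y / 2) * q.1) * rexp (-(π * y / 2) * q.2) := by
      rw [← Real.exp_add]
      refine Real.exp_le_exp.2 ?_
      have := mul_le_mul_of_nonneg_left (add_le_two_mul_mul h1 h2) hc.le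
      linarith
    calc |a q| * rexp (-π * (q.1 * q.2) * y)
        ≤ q.1 * (rexp (-(π * y / 2) * q.1) * rexp (-(π * y / 2) * q.2)) := by gcongr
      _ = _ := by simp; ring
  · have : |a q| = 0 := le_antisymm hq (abs_nonneg _)
    rw [this, zero_mul]
    exact mul_nonneg (by positivity) (by positivity)

lemma summable_onSimple_monomial {ω : ℤ → ℝ} {c : ℝ} (hc : 0 < c)
    (hω : ∀ D : ℤ, |ω D| ≤ rexp (-c * D)) (i j k : ℕ) :
    Summable (onSimple fun Q => (Q.2.1 : ℝ) ^ i * Q.1 ^ j * Q.2.2 ^ k * ω (formDisc Q)) := by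
  have hs := Summable.mul_of_nonneg (summable_int_pow_mul_exp j hc)
    (Summable.mul_of_nonneg (summable_int_pow_mul_exp i hc) (summable_int_pow_mul_exp k hc)
      (fun n => by positivity) (fun n => by positivity))
    (fun n => by positivity) (fun n => by positivity)
  refine Summable.of_norm_bounded hs fun Q => ?_
  obtain ⟨b, a, d⟩ := Q
  unfold onSimple
  split_ifs with h
  · have ha : (1 : ℝ) ≤ |(a : ℝ)| := by exact_mod_cast Int.one_le_abs h.1.ne'
    have hd : (1 : ℝ) ≤ |(d : ℝ)| := by exact_mod_cast Int.one_le_abs h.2.ne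
    have h0 : ((formDisc (b, a, d) : ℤ) : ℝ) = (b : ℝ) ^ 2 + 4 * (|(a : ℝ)| * |(d : ℝ)|) := by
      have h1 : |(a : ℝ)| = a := abs_of_pos (by exact_mod_cast h.1)
      have h2 : |(d : ℝ)| = -d := abs_of_neg (by exact_mod_cast h.2)
      rw [h1, h2]
      simp [formDisc]
      ring
    have h3 : |ω (formDisc (b, a, d))| ≤
        rexp (-c * |(b : ℝ)|) * (rexp (-c * |(a : ℝ)|) * rexp (-c * |(d : ℝ)|)) := by
      refine (hω _).trans ?_
      rw [← Real.exp_add, ← Real.exp_add, h0]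
      refine Real.exp_le_exp.2 ?_
      have hb := abs_intCast_le_sq b
      have := add_le_two_mul_mul ha hd
      nlinarith
    simp only [norm_mul, norm_pow, Real.norm_eq_abs]
    calc |(a : ℝ)| ^ i * |(b : ℝ)| ^ j * |(d : ℝ)| ^ k * |ω (formDisc (b, a, d))|
        ≤ |(a : ℝ)| ^ i * |(b : ℝ)| ^ j * |(d : ℝ)| ^ k *
          (rexp (-c * |(b : ℝ)|) * (rexp (-c * |(a : ℝ)|) * rexp (-c * |(d : ℝ)|))) := by gcongr
      _ = _ := by ring
  · simp only [norm_zero]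
    positivity

/-- The indicator function of odd integers. -/
def oddIndicator (m : ℤ) : ℝ := if Odd m then 1 else 0

/-- The sign `(-1)^m`. -/
def altSign (m : ℤ) : ℝ := if Even m then 1 else -1

/-- Coefficients of the Lambert series `∑ d q^{dk}` over odd `d` and `k`. -/
def oddLambertCoeff (q : ℕ × ℕ) : ℝ := if Odd q.1 ∧ Odd q.2 then q.1 else 0

/-- Coefficients of the Lambert series `∑ d q^{dk}` over all `d` and odd `k`. -/
def lambertCoeff (q : ℕ × ℕ) : ℝ := if Odd q.2 then q.1 else 0

/-- The Jacobi theta function `θ₂`, as the sum of `exp(-π m² y / 4)` over odd `m`. -/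
def thetaTwo : ℝ → ℝ := expSeries oddIndicator fun m => 1 / 4 * (m : ℝ) ^ 2

/-- The Jacobi theta function `θ₄`, as the sum of `(-1)^m exp(-π m² y)`. -/
def thetaFour : ℝ → ℝ := expSeries altSign fun m => 1 * (m : ℝ) ^ 2

/-- The Lambert series `∑ d exp(-π d k y)` over odd `d` and `k`. -/
def oddLambert : ℝ → ℝ := expSeries oddLambertCoeff fun q => (q.1 : ℝ) * q.2

/-- The Lambert series `∑ d exp(-π d k y)` over all `d` and odd `k`. -/
def lambert : ℝ → ℝ := expSeries lambertCoeff fun q => (q.1 : ℝ) * q.2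

lemma abs_altSign (m : ℤ) : |altSign m| = 1 := by
  unfold altSign
  split_ifs <;> simp

lemma isExpSummable_thetaTwo : IsExpSummable oddIndicator fun m : ℤ => 1 / 4 * (m : ℝ) ^ 2 :=
  summable_int_exp_sq (fun n => by unfold oddIndicator; split_ifs <;> simp) (by norm_num)

lemma isExpSummable_thetaFour : IsExpSummable altSign fun m : ℤ => 1 * (m : ℝ) ^ 2 :=
  summable_int_exp_sq (fun n => (abs_altSign n).le) one_pos

lemma abs_oddLambertCoeff_le (q : ℕ × ℕ) :
    |oddLambertCoeff q| ≤ if 0 < q.1 ∧ 0 < q.2 then (q.1 : ℝ) else 0 := by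
  unfold oddLambertCoeff
  split_ifs with h h' h'
  · simp
  · exact absurd ⟨h.1.pos, h.2.pos⟩ h'
  · simp
  · simp

lemma abs_lambertCoeff_le (q : ℕ × ℕ) :
    |lambertCoeff q| ≤ if 0 < q.1 ∧ 0 < q.2 then (q.1 : ℝ) else 0 := by
  unfold lambertCoeff
  split_ifs with h h' h'
  · simp
  · have : q.1 = 0 := by
      have := h.pos
      by_contra h0
      exact h' ⟨Nat.pos_of_ne_zero h0, this⟩
    simp [this]
  · simp
  · simp

lemma isExpSummable_oddLambert :
    IsExpSummable oddLambertCoeff fun q : ℕ × ℕ => (q.1 : ℝ) * q.2 :=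
  summable_lambert abs_oddLambertCoeff_le

lemma isExpSummable_lambert :
    IsExpSummable lambertCoeff fun q : ℕ × ℕ => (q.1 : ℝ) * q.2 :=
  summable_lambert abs_lambertCoeff_le

/-- Products of exponential series are double sums. -/
lemma expSeries_mul_expSeries {ι κ : Type*} {a p : ι → ℝ} {b q : κ → ℝ} (ha : IsExpSummable a p)
    (hb : IsExpSummable b q) {y : ℝ} (hy : 0 < y) :
    HasSum (fun z : ι × κ => a z.1 * rexp (-π * p z.1 * y) * (b z.2 * rexp (-π * q z.2 * y)))
      (expSeries a p y * expSeries b q y) := by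
  have h := summable_mul_of_summable_norm (ha.summable_norm hy) (hb.summable_norm hy)
  rw [expSeries, expSeries,
    tsum_mul_tsum_of_summable_norm (ha.summable_norm hy) (hb.summable_norm hy)]
  exact h.hasSum

lemma four_mul_thetaTwo_oddLambert {y : ℝ} (hy : 0 < y) :
    4 * expSeries (fun m => oddIndicator m * (1 / 4 * (m : ℝ) ^ 2)) (fun m => 1 / 4 * (m : ℝ) ^ 2) y
      * oddLambert y
    = thetaTwo y * expSeries (fun q => oddLambertCoeff q * ((q.1 : ℝ) * q.2))
      (fun q => (q.1 : ℝ) * q.2) y := by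
  have h1 := expSeries_mul_expSeries isExpSummable_thetaTwo.mul_frequency
    isExpSummable_oddLambert hy
  have h2 := expSeries_mul_expSeries isExpSummable_thetaTwo
    isExpSummable_oddLambert.mul_frequency hy
  have h3 := ((h1.mul_left 4).sub h2).tsum_eq
  have hc : 0 < π * y / 4 := by positivity
  obtain ⟨ω, hω⟩ : ∃ ω : ℤ → ℝ, ∀ D, ω D = rexp (-(π * y / 4) * D) := ⟨_, fun _ => rfl⟩
  have h4 := tsum_odd_simple_forms (ω := ω)
    (summable_onSimple_monomial hc fun D => by rw [hω, Real.abs_exp])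
  let φ : ℤ × (ℕ × ℕ) → ℤ × ℤ × ℤ := fun z => (z.1, (z.2.1 : ℤ), -(z.2.2 : ℤ))
  have hφ : Function.Injective φ := by
    rintro ⟨m, d, k⟩ ⟨m', d', k'⟩ h
    simp only [φ, Prod.mk.injEq, neg_inj, Nat.cast_inj] at h ⊢
    exact h
  rw [← hφ.tsum_eq] at h4
  · have h5 : 4 * (expSeries (fun m => oddIndicator m * (1 / 4 * (m : ℝ) ^ 2))
        (fun m => 1 / 4 * (m : ℝ) ^ 2) y * oddLambert y) -
        thetaTwo y * expSeries (fun q => oddLambertCoeff q * ((q.1 : ℝ) * q.2))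
          (fun q => (q.1 : ℝ) * q.2) y = 0 := by
      rw [← h4]
      refine h3.symm.trans (tsum_congr ?_)
      rintro ⟨m, d, k⟩
      by_cases h : Odd m ∧ Odd d ∧ Odd k
      · obtain ⟨hm, hd, hk⟩ := h
        have hd0 := hd.pos
        have hk0 := hk.pos
        have he : ω (formDisc (φ (m, d, k))) =
            rexp (-π * (1 / 4 * (m : ℝ) ^ 2) * y) * rexp (-π * (d * k) * y) := by
          rw [hω, ← Real.exp_add]
          simp only [formDisc, φ]
          push_cast
          ring_nf
        simp only [onSimple, he]
        simp [φ, oddIndicator, oddLambertCoeff, hm, hd, hk, hd0, hk0]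
        ring
      · have : oddIndicator m * oddLambertCoeff (d, k) = 0 := by
          simp only [oddIndicator, oddLambertCoeff]
          split_ifs <;> simp_all
        have h0 : onSimple (fun Q => if Odd Q.2.1 ∧ Odd Q.1 ∧ Odd Q.2.2 then
          ((Q.1 : ℝ) ^ 2 + Q.2.1 * Q.2.2) * Q.2.1 * ω (formDisc Q) else 0)
            (φ (m, d, k)) = 0 := by
          have : ¬(Odd d ∧ Odd m ∧ Odd k) := fun h' => h ⟨h'.2.1, h'.1, h'.2.2⟩
          simp [onSimple, φ, this]
        rw [h0]
        linear_combination ((m : ℝ) ^ 2 - d * k) * rexp (-π * (1 / 4 * (m : ℝ) ^ 2) * y) *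
          rexp (-π * (d * k) * y) * this
    linarith
  · intro Q hQ
    have : 0 < Q.2.1 ∧ Q.2.2 < 0 := by
      by_contra h
      exact hQ (by simp [onSimple, h])
    refine ⟨(Q.1, Q.2.1.toNat, (-Q.2.2).toNat), ?_⟩
    ext <;> simp [φ] <;> omega

/-- `θ₂⁴` and the odd Lambert series have the same logarithmic derivative. -/
theorem deriv_oddLambert_mul_thetaTwo {y : ℝ} (hy : 0 < y) :
    deriv oddLambert y * thetaTwo y = 4 * oddLambert y * deriv thetaTwo y := by
  have h1 : deriv oddLambert y = _ := (isExpSummable_oddLambert.hasDerivAt hy).deriv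
  have h2 : deriv thetaTwo y = _ := (isExpSummable_thetaTwo.hasDerivAt hy).deriv
  rw [h1, h2]
  linear_combination π * four_mul_thetaTwo_oddLambert hy

/-- `(-1)^{D/4} exp(-π y D / 4)` as a weight on discriminants. -/
def signedWeight (y : ℝ) (D : ℤ) : ℝ := altSign (D / 4) * rexp (-(π * y / 4) * D)

lemma signedWeight_four_mul (y : ℝ) (N : ℤ) :
    signedWeight y (4 * N) = altSign N * rexp (-π * N * y) := by
  rw [signedWeight, Int.mul_ediv_cancel_left _ (by norm_num)]
  push_cast
  ring_nf

lemma altSign_sq (s : ℤ) : altSign (s ^ 2) = altSign s := by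
  simp [altSign, Int.even_pow]

lemma summable_signedWeight {y : ℝ} (hy : 0 < y) (i j k : ℕ) : Summable
    (onSimple fun Q => (Q.2.1 : ℝ) ^ i * Q.1 ^ j * Q.2.2 ^ k * signedWeight y (formDisc Q)) := by
  refine summable_onSimple_monomial (by positivity : 0 < π * y / 4) (fun D => ?_) i j k
  rw [signedWeight, abs_mul, abs_altSign, one_mul, Real.abs_exp]

lemma tsum_boundary_simple_forms {y : ℝ} (hy : 0 < y) :
    ∑' Q, onSimple (fun Q => if Odd Q.2.1 ∧ Odd Q.2.2 ∧ Q.2.1 - Q.1 + Q.2.2 = 0 then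
      ((Q.2.1 : ℝ) - Q.2.2) * signedWeight y (formDisc Q) else 0) Q =
    expSeries (fun m => altSign m * (1 * (m : ℝ) ^ 2)) (fun m => 1 * (m : ℝ) ^ 2) y := by
  set G := onSimple (fun Q => if Odd Q.2.1 ∧ Odd Q.2.2 ∧ Q.2.1 - Q.1 + Q.2.2 = 0 then
      ((Q.2.1 : ℝ) - Q.2.2) * signedWeight y (formDisc Q) else 0) with hG
  have hGs : Summable G := by
    refine Summable.of_norm_bounded
      ((summable_signedWeight hy 1 0 0).norm.add (summable_signedWeight hy 0 0 1).norm) fun Q => ?_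
    simp only [hG, onSimple]
    by_cases h : 0 < Q.2.1 ∧ Q.2.2 < 0
    · rw [if_pos h, if_pos h, if_pos h]
      split_ifs with h'
      · simp only [pow_one, pow_zero, mul_one, one_mul, sub_mul]
        exact norm_sub_le _ _
      · rw [norm_zero]
        positivity
    · simp [h]
  let φ : (Σ s : ℕ, Fin s) → ℤ × ℤ × ℤ := fun z =>
    (4 * (z.2 : ℤ) + 2 - 2 * z.1, 2 * (z.2 : ℤ) + 1, 2 * (z.2 : ℤ) + 1 - 2 * z.1)
  have hφ : Function.Injective φ := by
    rintro ⟨s, i, hi⟩ ⟨s', i', hi'⟩ h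
    simp only [φ, Prod.mk.injEq] at h
    obtain ⟨-, h1, h2⟩ := h
    obtain rfl : s = s' := by omega
    obtain rfl : i = i' := by omega
    rfl
  have hval : ∀ z, G (φ z) =
      2 * (z.1 : ℝ) * (altSign z.1 * rexp (-π * (1 * (z.1 : ℝ) ^ 2) * y)) := by
    rintro ⟨s, i, hi⟩
    have hd : formDisc (φ ⟨s, i, hi⟩) = 4 * (s : ℤ) ^ 2 := by
      simp only [formDisc, φ]
      ring
    have h1 : 0 < (φ ⟨s, i, hi⟩).2.1 ∧ (φ ⟨s, i, hi⟩).2.2 < 0 := by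
      simp only [φ]
      omega
    have h2 : Odd (φ ⟨s, i, hi⟩).2.1 ∧ Odd (φ ⟨s, i, hi⟩).2.2 ∧
        (φ ⟨s, i, hi⟩).2.1 - (φ ⟨s, i, hi⟩).1 + (φ ⟨s, i, hi⟩).2.2 = 0 := by
      refine ⟨⟨i, rfl⟩, ⟨i - s, ?_⟩, ?_⟩ <;> simp only [φ] <;> ring
    simp only [hG, onSimple, if_pos h1, if_pos h2, hd, signedWeight_four_mul, altSign_sq]
    simp only [φ]
    push_cast
    ring_nf
  have hrange : Function.support G ⊆ Set.range φ := by
    intro Q hQ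
    have h1 : 0 < Q.2.1 ∧ Q.2.2 < 0 := by
      by_contra h
      exact hQ (by simp [hG, onSimple, h])
    have h2 : Odd Q.2.1 ∧ Odd Q.2.2 ∧ Q.2.1 - Q.1 + Q.2.2 = 0 := by
      by_contra h
      exact hQ (by simp [hG, onSimple, h])
    obtain ⟨b, a, d⟩ := Q
    obtain ⟨⟨i, hi⟩, ⟨j, hj⟩, h3⟩ := h2
    simp only at h1 hi hj h3
    refine ⟨⟨(i - j).toNat, ⟨i.toNat, by omega⟩⟩, ?_⟩
    simp only [φ, Prod.mk.injEq]
    omega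
  rw [← hφ.tsum_eq hrange, Summable.tsum_sigma' (fun s => (hasSum_fintype _).summable)
    (show Summable fun z => G (φ z) from hGs.comp_injective hφ)]
  set f : ℤ → ℝ := fun m =>
    altSign m * (1 * (m : ℝ) ^ 2) * rexp (-π * (1 * (m : ℝ) ^ 2) * y) with hf
  have hfs : Summable f := (isExpSummable_thetaFour.mul_frequency.hasSum hy).summable
  have hneg : ∀ n : ℕ, f (-(n : ℤ)) = f n := fun n => by simp [hf, altSign]
  have h1 : Summable fun n : ℕ => f n := hfs.comp_injective Nat.cast_injective
  have h2 := Summable.tsum_of_nat_of_neg h1 (by simpa only [hneg] using h1)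
  simp only [hneg] at h2
  have h3 : ∀ s : ℕ, ∑' i : Fin s, G (φ ⟨s, i⟩) = 2 * f s := fun s => by
    simp only [hval, tsum_fintype, Finset.sum_const, Finset.card_univ, Fintype.card_fin,
      nsmul_eq_mul, hf]
    push_cast
    ring
  change _ = ∑' m, f m
  rw [h2, tsum_congr h3, tsum_mul_left]
  have : f 0 = 0 := by simp [hf]
  rw [this]
  ring

lemma lambert_mul_thetaFour {y : ℝ} (hy : 0 < y) :
    lambert y * thetaFour y = -(1 / 2) *
      expSeries (fun m => altSign m * (1 * (m : ℝ) ^ 2)) (fun m => 1 * (m : ℝ) ^ 2) y := by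
  have h1 := (expSeries_mul_expSeries isExpSummable_thetaFour isExpSummable_lambert hy).tsum_eq
  have h4 := tsum_even_simple_forms (ω := signedWeight y) (summable_signedWeight hy)
  rw [tsum_boundary_simple_forms hy] at h4
  rw [← h4, mul_comm]
  refine h1.symm.trans ?_
  let φ : ℤ × (ℕ × ℕ) → ℤ × ℤ × ℤ := fun z => (2 * z.1, (z.2.2 : ℤ), -(z.2.1 : ℤ))
  have hφ : Function.Injective φ := by
    rintro ⟨m, d, k⟩ ⟨m', d', k'⟩ h
    simp only [φ, Prod.mk.injEq, neg_inj, Nat.cast_inj] at h ⊢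
    omega
  rw [← hφ.tsum_eq]
  · refine tsum_congr ?_
    rintro ⟨m, d, k⟩
    by_cases hk : Odd k
    · have hd : formDisc (φ (m, d, k)) = 4 * (m ^ 2 + d * k) := by
        simp only [formDisc, φ]
        ring
      have he : rexp (-π * ((m ^ 2 + d * k : ℤ) : ℝ) * y) =
            rexp (-π * (1 * (m : ℝ) ^ 2) * y) * rexp (-π * (d * k) * y) := by
        rw [← Real.exp_add]
        push_cast
        ring_nf
      have hs : altSign (m ^ 2 + d * k) = altSign m * altSign d := by
        have hk' : ¬ Even (k : ℤ) := by simpa using hk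
        by_cases h1 : Even m <;> by_cases h2 : Even (d : ℤ) <;>
          simp [altSign, Int.even_add, Int.even_mul, Int.even_pow, h1, h2, hk']
      rcases Nat.eq_zero_or_pos d with rfl | hd0
      · simp [onSimple, φ, lambertCoeff]
      · simp only [onSimple, hd, signedWeight_four_mul, he, hs]
        have hk0 := hk.pos
        by_cases h2 : Even d <;> by_cases h3 : Even m <;>
          simp [φ, lambertCoeff, hk, hd0, hk0, altSign, h2, h3] <;> ring
    · simp [onSimple, φ, lambertCoeff, hk]
  · intro Q hQ
    have h1 : 0 < Q.2.1 ∧ Q.2.2 < 0 := by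
      by_contra h
      exact hQ (by simp [onSimple, h])
    have h2 : Even Q.1 := by
      by_contra h
      exact hQ (by simp [onSimple, h])
    obtain ⟨b, a, d⟩ := Q
    obtain ⟨m, hm⟩ := h2
    simp only at h1 hm
    refine ⟨(m, (-d).toNat, a.toNat), ?_⟩
    simp only [φ, Prod.mk.injEq]
    omega

/-- The logarithmic derivative of `θ₄` is a Lambert series. -/
theorem deriv_thetaFour {y : ℝ} (hy : 0 < y) :
    deriv thetaFour y = 2 * π * lambert y * thetaFour y := by
  have h1 : deriv thetaFour y = _ := (isExpSummable_thetaFour.hasDerivAt hy).deriv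
  rw [h1]
  linear_combination -(2 * π) * lambert_mul_thetaFour hy

lemma thetaTwo_eq_evenKernel {y : ℝ} (hy : 0 < y) :
    thetaTwo y = HurwitzZeta.evenKernel ((1 / 2 : ℝ) : UnitAddCircle) y := by
  rw [← (HurwitzZeta.hasSum_int_evenKernel (1 / 2) hy).tsum_eq, thetaTwo, expSeries]
  have hφ : Function.Injective fun n : ℤ => 2 * n + 1 := fun a b h => by
    simp only at h
    omega
  rw [← hφ.tsum_eq]
  · refine tsum_congr fun n => ?_
    have : Odd (2 * n + 1) := ⟨n, rfl⟩
    rw [oddIndicator, if_pos this, one_mul]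
    push_cast
    ring_nf
  · intro m hm
    have : Odd m := by
      by_contra h
      exact hm (by simp [oddIndicator, h])
    obtain ⟨n, rfl⟩ := this
    exact ⟨n, rfl⟩

lemma thetaFour_eq_cosKernel {y : ℝ} (hy : 0 < y) :
    thetaFour y = HurwitzZeta.cosKernel ((1 / 2 : ℝ) : UnitAddCircle) y := by
  rw [← Complex.ofReal_inj, ← (HurwitzZeta.hasSum_int_cosKernel (1 / 2) hy).tsum_eq, thetaFour,
    expSeries, Complex.ofReal_tsum]
  refine tsum_congr fun n => ?_
  have h1 : cexp (2 * π * I * ((1 / 2 : ℝ) : ℂ) * n) = altSign n := by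
    have : 2 * π * I * ((1 / 2 : ℝ) : ℂ) * n = n * (π * I) := by
      push_cast
      ring
    rw [this, Complex.exp_int_mul, Complex.exp_pi_mul_I, altSign]
    split_ifs with h
    · simp [h.neg_one_zpow]
    · simp [(Int.not_even_iff_odd.1 h).neg_one_zpow]
  rw [h1]
  push_cast
  ring_nf

lemma thetaTwo_inv_pow_four {y : ℝ} (hy : 0 < y) :
    thetaTwo y⁻¹ ^ 4 = y ^ 2 * thetaFour y ^ 4 := by
  rw [thetaTwo_eq_evenKernel (inv_pos.2 hy), HurwitzZeta.evenKernel_functional_equation,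
    one_div y⁻¹, inv_inv, ← thetaFour_eq_cosKernel hy, mul_pow, ← Real.sqrt_eq_rpow,
    Real.sqrt_inv, one_div, inv_inv]
  have : √y ^ 4 = y ^ 2 := by
    rw [show 4 = 2 * 2 from rfl, pow_mul, Real.sq_sqrt hy.le]
  rw [this]

lemma thetaTwo_pos {y : ℝ} (hy : 0 < y) : 0 < thetaTwo y := by
  refine (isExpSummable_thetaTwo.hasSum hy).summable.tsum_pos (fun m => ?_) 1 ?_
  · exact mul_nonneg (by unfold oddIndicator; split_ifs <;> simp) (Real.exp_pos _).le
  · simp [oddIndicator, Real.exp_pos]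

/-- The odd Lambert series is a constant multiple of `θ₂⁴`. -/
theorem exists_oddLambert_eq_mul_thetaTwo :
    ∃ c : ℝ, ∀ y, 0 < y → oddLambert y = c * thetaTwo y ^ 4 := by
  have hd : ∀ y ∈ Set.Ioi (0 : ℝ), HasDerivAt (fun y => oddLambert y / thetaTwo y ^ 4) 0 y := by
    intro y hy
    have h1 := (isExpSummable_oddLambert.hasDerivAt hy).differentiableAt.hasDerivAt
    have h2 := (isExpSummable_thetaTwo.hasDerivAt hy).differentiableAt.hasDerivAt
    have hne : thetaTwo y ≠ 0 := (thetaTwo_pos hy).ne'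
    have key := h1.fun_div (h2.fun_pow 4) (pow_ne_zero 4 hne)
    refine key.congr_deriv ?_
    have h3 : deriv oddLambert y * thetaTwo y = 4 * oddLambert y * deriv thetaTwo y :=
      deriv_oddLambert_mul_thetaTwo hy
    rw [div_eq_zero_iff]
    left
    change deriv oddLambert y * thetaTwo y ^ 4 -
      oddLambert y * ((4 : ℕ) * thetaTwo y ^ (4 - 1) * deriv thetaTwo y) = 0
    push_cast
    linear_combination thetaTwo y ^ 3 * h3
  refine ⟨oddLambert 1 / thetaTwo 1 ^ 4, fun y hy => ?_⟩
  have h := isOpen_Ioi.is_const_of_deriv_eq_zero (isPreconnected_Ioi (a := (0 : ℝ)))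
    (fun y hy => (hd y hy).differentiableAt.differentiableWithinAt) (fun y hy => (hd y hy).deriv)
    (Set.mem_Ioi.2 hy) (Set.mem_Ioi.2 one_pos)
  rw [← h, div_mul_cancel₀ _ (pow_ne_zero 4 (ne_of_gt (thetaTwo_pos hy)))]

/-- The product of the Lambert series at `y` and the odd Lambert series at `1 / y`. -/
theorem lambert_mul_oddLambert_inv {y : ℝ} (hy : 0 < y) :
    lambert y * oddLambert y⁻¹ =
      1 / (8 * π) * (-(2 * y⁻¹ * oddLambert y⁻¹) - (y ^ 2)⁻¹ * deriv oddLambert y⁻¹) := by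
  obtain ⟨c, hc⟩ := exists_oddLambert_eq_mul_thetaTwo
  have hB : ∀ x, 0 < x → oddLambert x⁻¹ = c * (x ^ 2 * thetaFour x ^ 4) := fun x hx => by
    rw [hc _ (inv_pos.2 hx), thetaTwo_inv_pow_four hx]
  have h1 : HasDerivAt (fun x => oddLambert x⁻¹) (deriv oddLambert y⁻¹ * (-(y ^ 2)⁻¹)) y :=
    (isExpSummable_oddLambert.hasDerivAt (inv_pos.2 hy)).differentiableAt.hasDerivAt.comp y
      (hasDerivAt_inv hy.ne')
  have h2 : HasDerivAt thetaFour (deriv thetaFour y) y :=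
    (isExpSummable_thetaFour.hasDerivAt hy).differentiableAt.hasDerivAt
  have h3 := ((hasDerivAt_pow 2 y).fun_mul (h2.fun_pow 4)).const_mul c
  have h4 := (h3.congr_of_eventuallyEq
    (Filter.eventuallyEq_of_mem (Ioi_mem_nhds hy) fun x hx => hB x hx)).unique h1
  rw [deriv_thetaFour hy] at h4
  have hpi : π ≠ 0 := Real.pi_ne_zero
  have hy0 : y ≠ 0 := hy.ne'
  have h5 : (y ^ 2)⁻¹ * deriv oddLambert y⁻¹ =
    -(2 * y⁻¹ * oddLambert y⁻¹) - 8 * π * lambert y * oddLambert y⁻¹ := by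
    rw [hB y hy]
    push_cast at h4
    field_simp at h4 ⊢
    linear_combination h4
  rw [h5]
  field_simp
  ring

lemma summable_lambert_div_rpow {a : ℕ × ℕ → ℝ}
    (ha : ∀ q, |a q| ≤ if 0 < q.1 ∧ 0 < q.2 then (q.1 : ℝ) else 0) {σ : ℝ} (hσ : 2 < σ) :
    Summable fun q : ℕ × ℕ => |a q| / ((q.1 : ℝ) * q.2) ^ σ := by
  have hs := Summable.mul_of_nonneg
    (Real.summable_one_div_nat_rpow.2 (by linarith : 1 < σ - 1))
    (Real.summable_one_div_nat_rpow.2 (by linarith : 1 < σ))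
    (fun n => by positivity) (fun n => by positivity)
  refine Summable.of_nonneg_of_le (fun q => by positivity) (fun q => ?_) hs
  have hq := ha q
  split_ifs at hq with h
  · have h1 : (0 : ℝ) < q.1 := by exact_mod_cast h.1
    have h2 : (0 : ℝ) < q.2 := by exact_mod_cast h.2
    rw [Real.mul_rpow h1.le h2.le, Real.rpow_sub_one h1.ne']
    calc |a q| / ((q.1 : ℝ) ^ σ * (q.2 : ℝ) ^ σ) ≤ q.1 / ((q.1 : ℝ) ^ σ * (q.2 : ℝ) ^ σ) := by
          gcongr
      _ = _ := by
          field_simp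
  · rw [le_antisymm hq (abs_nonneg _), zero_div]
    positivity

lemma IsExpSummable.exists_abs_expSeries_le {ι : Type*} {a p : ι → ℝ} (h : IsExpSummable a p)
    (hp : ∀ i, a i = 0 ∨ 0 < p i) {n : ℕ} (hs : Summable fun i => |a i| / p i ^ (n : ℝ)) :
    ∃ C, ∀ y, 0 < y → |expSeries a p y| ≤ C * y ^ (-(n : ℝ)) := by
  refine ⟨(n.factorial / π ^ n) * ∑' i, |a i| / p i ^ (n : ℝ), fun y hy => ?_⟩
  have h1 : |expSeries a p y| ≤ ∑' i, |a i| * rexp (-π * p i * y) := by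
    have := norm_tsum_le_tsum_norm (h.summable_norm hy)
    simpa [abs_mul, expSeries] using this
  refine h1.trans ?_
  rw [mul_assoc, ← tsum_mul_right, ← tsum_mul_left]
  refine Summable.tsum_le_tsum (fun i => ?_) (h.summable y hy)
    ((hs.mul_right _).mul_left _)
  rcases hp i with h0 | h0
  · simp [h0]
  · have hx : 0 < π * p i * y := by positivity
    have h2 := Real.pow_div_factorial_le_exp _ hx.le n
    have h3 : rexp (-π * p i * y) ≤ n.factorial / (π * p i * y) ^ n := by
      rw [show -π * p i * y = -(π * p i * y) by ring, Real.exp_neg, ← inv_div]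
      gcongr
    rw [Real.rpow_neg hy.le, Real.rpow_natCast, Real.rpow_natCast]
    calc |a i| * rexp (-π * p i * y) ≤ |a i| * (n.factorial / (π * p i * y) ^ n) := by gcongr
      _ = _ := by
          rw [mul_pow, mul_pow]
          field_simp

lemma isBigO_ofReal_of_abs_le {f : ℝ → ℝ} {C a : ℝ} (h : ∀ y, 0 < y → |f y| ≤ C * y ^ a)
    {l : Filter ℝ} (hl : ∀ᶠ y in l, 0 < y) :
    (fun y => (f y : ℂ)) =O[l] fun y => y ^ a := by
  refine Asymptotics.IsBigO.of_bound C (hl.mono fun y hy => ?_)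
  rw [Complex.norm_real, Real.norm_eq_abs, Real.norm_of_nonneg (Real.rpow_nonneg hy.le a)]
  exact h y hy

lemma locallyIntegrableOn_ofReal {f : ℝ → ℝ} (hf : ContinuousOn f (Set.Ioi 0)) :
    LocallyIntegrableOn (fun y => (f y : ℂ)) (Set.Ioi 0) :=
  (Complex.continuous_ofReal.comp_continuousOn hf).locallyIntegrableOn measurableSet_Ioi

lemma mellinConvergent_of_abs_le {f : ℝ → ℝ} (hf : ContinuousOn f (Set.Ioi 0)) {a b : ℝ}
    {s : ℂ} (ha : ∃ C, ∀ y, 0 < y → |f y| ≤ C * y ^ (-a))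
    (hb : ∃ C, ∀ y, 0 < y → |f y| ≤ C * y ^ (-b)) (hs : s.re < a) (hs' : b < s.re) :
    MellinConvergent (fun y => (f y : ℂ)) s := by
  obtain ⟨C, hC⟩ := ha
  obtain ⟨C', hC'⟩ := hb
  exact mellinConvergent_of_isBigO_rpow (locallyIntegrableOn_ofReal hf)
    (isBigO_ofReal_of_abs_le hC (Filter.eventually_gt_atTop 0)) hs
    (isBigO_ofReal_of_abs_le hC' self_mem_nhdsWithin) hs'

lemma differentiableAt_mellin_of_abs_le {f : ℝ → ℝ} (hf : ContinuousOn f (Set.Ioi 0)) {a b : ℝ}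
    {s : ℂ} (ha : ∃ C, ∀ y, 0 < y → |f y| ≤ C * y ^ (-a))
    (hb : ∃ C, ∀ y, 0 < y → |f y| ≤ C * y ^ (-b)) (hs : s.re < a) (hs' : b < s.re) :
    DifferentiableAt ℂ (mellin fun y => (f y : ℂ)) s := by
  obtain ⟨C, hC⟩ := ha
  obtain ⟨C', hC'⟩ := hb
  exact mellin_differentiableAt_of_isBigO_rpow (locallyIntegrableOn_ofReal hf)
    (isBigO_ofReal_of_abs_le hC (Filter.eventually_gt_atTop 0)) hs
    (isBigO_ofReal_of_abs_le hC' self_mem_nhdsWithin) hs'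

lemma lambertCoeff_eq_zero_or_pos {a : ℕ × ℕ → ℝ}
    (ha : ∀ q, |a q| ≤ if 0 < q.1 ∧ 0 < q.2 then (q.1 : ℝ) else 0) (q : ℕ × ℕ) :
    a q = 0 ∨ 0 < (q.1 : ℝ) * q.2 := by
  have hq := ha q
  split_ifs at hq with h
  · have h1 : (0 : ℝ) < q.1 := by exact_mod_cast h.1
    have h2 : (0 : ℝ) < q.2 := by exact_mod_cast h.2
    exact Or.inr (mul_pos h1 h2)
  · exact Or.inl (abs_eq_zero.1 (le_antisymm hq (abs_nonneg _)))

lemma exists_abs_lambert_le {a : ℕ × ℕ → ℝ}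
    (ha : ∀ q, |a q| ≤ if 0 < q.1 ∧ 0 < q.2 then (q.1 : ℝ) else 0) {n : ℕ} (hn : 3 ≤ n) :
    ∃ C, ∀ y, 0 < y →
      |expSeries a (fun q => (q.1 : ℝ) * q.2) y| ≤ C * y ^ (-(n : ℝ)) := by
  have h : (3 : ℝ) ≤ n := by exact_mod_cast hn
  exact (summable_lambert ha).exists_abs_expSeries_le (lambertCoeff_eq_zero_or_pos ha)
    (summable_lambert_div_rpow ha (by linarith))

lemma exists_abs_lambert_mul_frequency_le {a : ℕ × ℕ → ℝ}
    (ha : ∀ q, |a q| ≤ if 0 < q.1 ∧ 0 < q.2 then (q.1 : ℝ) else 0) {n : ℕ} (hn : 4 ≤ n) :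
    ∃ C, ∀ y, 0 < y → |expSeries (fun q => a q * ((q.1 : ℝ) * q.2)) (fun q => (q.1 : ℝ) * q.2) y|
      ≤ C * y ^ (-(n : ℝ)) := by
  have h : (4 : ℝ) ≤ n := by exact_mod_cast hn
  refine (summable_lambert ha).mul_frequency.exists_abs_expSeries_le (fun q => ?_) ?_
  · exact (lambertCoeff_eq_zero_or_pos ha q).imp_left fun h => by rw [h, zero_mul]
  · refine (summable_lambert_div_rpow ha (by linarith : 2 < (n : ℝ) - 1)).congr fun q => ?_
    rcases lambertCoeff_eq_zero_or_pos ha q with h | h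
    · simp [h]
    · rw [Real.rpow_sub_one h.ne', abs_mul, abs_of_pos h]
      field_simp

/-- The kernel whose Mellin transform is the Bessel series. -/
def crossKernel (y : ℝ) : ℝ := lambert y * oddLambert y⁻¹

lemma continuousOn_crossKernel : ContinuousOn crossKernel (Set.Ioi 0) :=
  isExpSummable_lambert.continuousOn.mul (isExpSummable_oddLambert.continuousOn.comp
    (continuousOn_inv₀.mono fun _ hy => (ne_of_gt hy)) fun _ hy => Set.mem_Ioi.2 (inv_pos.2 hy))

lemma exists_abs_crossKernel_le {m n : ℕ} (hm : 3 ≤ m) (hn : 3 ≤ n) :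
    ∃ C, ∀ y, 0 < y → |crossKernel y| ≤ C * y ^ (-((m : ℝ) - n)) := by
  obtain ⟨C, hC⟩ := exists_abs_lambert_le abs_lambertCoeff_le hm
  obtain ⟨C', hC'⟩ := exists_abs_lambert_le abs_oddLambertCoeff_le hn
  refine ⟨C * C', fun y hy => ?_⟩
  have h1 := hC y hy
  have h2 := hC' y⁻¹ (inv_pos.2 hy)
  rw [Real.inv_rpow hy.le, Real.rpow_neg hy.le, inv_inv] at h2
  rw [crossKernel, abs_mul, show -((m : ℝ) - n) = -m + n by ring, Real.rpow_add hy]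
  calc |lambert y| * |oddLambert y⁻¹| ≤ (C * y ^ (-(m : ℝ))) * (C' * y ^ (n : ℝ)) :=
        mul_le_mul h1 h2 (abs_nonneg _) ((abs_nonneg _).trans h1)
    _ = _ := by ring

lemma exists_bounds_crossKernel (s : ℂ) : ∃ a b : ℝ, s.re < a ∧ b < s.re ∧
    (∃ C, ∀ y, 0 < y → |crossKernel y| ≤ C * y ^ (-a)) ∧
    ∃ C, ∀ y, 0 < y → |crossKernel y| ≤ C * y ^ (-b) := by
  obtain ⟨k, hk⟩ := exists_nat_gt |s.re|
  obtain ⟨h1, h2⟩ := abs_lt.1 hk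
  refine ⟨((3 + k : ℕ) : ℝ) - (3 : ℕ), ((3 : ℕ) : ℝ) - (3 + k : ℕ), ?_, ?_,
    exists_abs_crossKernel_le (by omega) le_rfl, exists_abs_crossKernel_le le_rfl (by omega)⟩ <;>
  · push_cast
    linarith

lemma mellinConvergent_crossKernel (s : ℂ) :
    MellinConvergent (fun y => (crossKernel y : ℂ)) s := by
  obtain ⟨a, b, ha, hb, hC, hC'⟩ := exists_bounds_crossKernel s
  exact mellinConvergent_of_abs_le continuousOn_crossKernel hC hC' ha hb

lemma differentiable_mellin_crossKernel :
    Differentiable ℂ (mellin fun y => (crossKernel y : ℂ)) := fun s => by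
  obtain ⟨a, b, ha, hb, hC, hC'⟩ := exists_bounds_crossKernel s
  exact differentiableAt_mellin_of_abs_le continuousOn_crossKernel hC hC' ha hb

lemma summable_odd_one_div_cpow {w : ℂ} (hw : 1 < w.re) :
    Summable fun n : ℕ => ‖if Odd n then 1 / (n : ℂ) ^ w else 0‖ := by
  refine Summable.of_nonneg_of_le (fun n => norm_nonneg _) (fun n => ?_)
    (Complex.summable_one_div_nat_cpow.2 hw).norm
  split_ifs
  · exact le_rfl
  · simp

lemma tsum_odd_one_div_cpow {w : ℂ} (hw : 1 < w.re) :
    ∑' n : ℕ, (if Odd n then 1 / (n : ℂ) ^ w else 0) = (1 - 2 ^ (-w)) * riemannZeta w := by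
  have hf := Complex.summable_one_div_nat_cpow.2 hw
  have hodd : Function.Injective fun n : ℕ => 2 * n + 1 := fun a b h => by
    simp only at h
    omega
  have heven : Function.Injective fun n : ℕ => 2 * n := fun a b h => by
    simp only at h
    omega
  have h1 := tsum_even_add_odd (f := fun n : ℕ => 1 / (n : ℂ) ^ w)
    (hf.comp_injective heven) (hf.comp_injective hodd)
  have h2 : ∑' n : ℕ, (if Odd n then 1 / (n : ℂ) ^ w else 0) =
      ∑' n : ℕ, 1 / ((2 * n + 1 : ℕ) : ℂ) ^ w := by
    rw [← hodd.tsum_eq]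
    · exact tsum_congr fun n => by rw [if_pos ⟨n, rfl⟩]
    · intro n hn
      have : Odd n := by
        by_contra h
        exact hn (by simp [h])
      obtain ⟨k, rfl⟩ := this
      exact ⟨k, rfl⟩
  have h3 : ∑' n : ℕ, 1 / ((2 * n : ℕ) : ℂ) ^ w = 2 ^ (-w) * ∑' n : ℕ, 1 / (n : ℂ) ^ w := by
    rw [← tsum_mul_left]
    refine tsum_congr fun n => ?_
    have := Complex.natCast_mul_natCast_cpow 2 n w
    push_cast at this ⊢
    rw [this, Complex.cpow_neg]
    field_simp
  rw [h2, zeta_eq_tsum_one_div_nat_cpow hw]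
  linear_combination h1 - h3

/-- The Dirichlet series of the odd Lambert coefficients. -/
lemma tsum_oddLambertCoeff_div_cpow {v : ℂ} (hv : 2 < v.re) :
    ∑' q : ℕ × ℕ, (oddLambertCoeff q : ℂ) / (((q.1 : ℝ) * q.2 : ℝ) : ℂ) ^ v =
      (1 - 2 ^ (1 - v)) * riemannZeta (v - 1) * ((1 - 2 ^ (-v)) * riemannZeta v) := by
  have h1 : 1 < (v - 1).re := by
    rw [Complex.sub_re, Complex.one_re]
    linarith
  have h2 : 1 < v.re := by linarith
  rw [show 1 - v = -(v - 1) by ring, ← tsum_odd_one_div_cpow h1, ← tsum_odd_one_div_cpow h2,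
    tsum_mul_tsum_of_summable_norm (summable_odd_one_div_cpow h1) (summable_odd_one_div_cpow h2)]
  refine tsum_congr fun q => ?_
  obtain ⟨d, k⟩ := q
  have h3 := Complex.natCast_mul_natCast_cpow d k v
  push_cast
  rw [h3]
  by_cases hd : Odd d <;> by_cases hk : Odd k
  · have hd0 : (d : ℂ) ≠ 0 := by exact_mod_cast hd.pos.ne'
    simp only [oddLambertCoeff, hd, hk, and_self, if_true, Complex.ofReal_natCast]
    rw [Complex.cpow_sub _ _ hd0, Complex.cpow_one]
    field_simp
  all_goals simp [oddLambertCoeff, hd, hk]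

lemma mellin_oddLambert {v : ℂ} (hv : 2 < v.re) :
    mellin (fun y => (oddLambert y : ℂ)) v = π ^ (-v) * Complex.Gamma v *
      ∑' q : ℕ × ℕ, (oddLambertCoeff q : ℂ) / (((q.1 : ℝ) * q.2 : ℝ) : ℂ) ^ v := by
  have h := hasSum_mellin_pi_mul (a := fun q => (oddLambertCoeff q : ℂ))
    (q := fun q : ℕ × ℕ => (q.1 : ℝ) * q.2) (F := fun y => (oddLambert y : ℂ)) (s := v)
    (fun q => (lambertCoeff_eq_zero_or_pos abs_oddLambertCoeff_le q).imp_left fun h => by simp [h])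
    (by linarith) (fun t ht => ?_) ?_
  · rw [← h.tsum_eq, ← tsum_mul_left]
    exact tsum_congr fun q => by ring
  · have h1 : HasSum _ (oddLambert t) := isExpSummable_oddLambert.hasSum ht
    simpa only [Complex.ofReal_mul] using Complex.hasSum_ofReal.2 h1
  · simpa using summable_lambert_div_rpow abs_oddLambertCoeff_le hv

lemma mellin_deriv_oddLambert {v : ℂ} (hv : 2 < v.re) :
    mellin (fun y => ((deriv oddLambert y : ℝ) : ℂ)) (v + 1) = -(v * π ^ (-v) * Complex.Gamma v *
      ∑' q : ℕ × ℕ, (oddLambertCoeff q : ℂ) / (((q.1 : ℝ) * q.2 : ℝ) : ℂ) ^ v) := by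
  have hv0 : v ≠ 0 := fun h => by
    rw [h, Complex.zero_re] at hv
    linarith
  have hpi : (π : ℂ) ≠ 0 := by exact_mod_cast Real.pi_ne_zero
  have hc := lambertCoeff_eq_zero_or_pos abs_oddLambertCoeff_le
  have h := hasSum_mellin_pi_mul
    (a := fun q : ℕ × ℕ => ((-π * (oddLambertCoeff q * ((q.1 : ℝ) * q.2)) : ℝ) : ℂ))
    (q := fun q : ℕ × ℕ => (q.1 : ℝ) * q.2) (F := fun y => ((deriv oddLambert y : ℝ) : ℂ))
    (s := v + 1)
    (fun q => (hc q).imp_left fun h => by simp [h])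
    (by rw [Complex.add_re, Complex.one_re]; linarith) (fun t ht => ?_) ?_
  · rw [← h.tsum_eq, ← tsum_mul_left, ← tsum_neg]
    refine tsum_congr fun q => ?_
    rcases hc q with h0 | h0
    · simp [h0]
    · have h1 : (((q.1 : ℝ) * q.2 : ℝ) : ℂ) ≠ 0 := by exact_mod_cast h0.ne'
      rw [Complex.Gamma_add_one _ hv0, Complex.cpow_add _ _ h1, Complex.cpow_one, neg_add,
        Complex.cpow_add _ _ hpi, Complex.cpow_neg_one]
      rw [Complex.ofReal_mul, Complex.ofReal_mul (oddLambertCoeff q), Complex.ofReal_neg]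
      field_simp
  · have h1 : deriv oddLambert t = _ := (isExpSummable_oddLambert.hasDerivAt ht).deriv
    have h2 := (isExpSummable_oddLambert.mul_frequency.hasSum ht).mul_left (-π)
    rw [← h1] at h2
    refine (Complex.hasSum_ofReal.2 h2).congr_fun fun q => ?_
    push_cast
    ring
  · refine ((summable_lambert_div_rpow abs_oddLambertCoeff_le hv).mul_left π).congr fun q => ?_
    rcases hc q with h0 | h0
    · simp [h0]
    · rw [Complex.norm_real, Real.norm_eq_abs, abs_mul, abs_neg, abs_of_pos Real.pi_pos, abs_mul,
        abs_of_pos h0, Complex.add_re, Complex.one_re, Real.rpow_add_one h0.ne']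
      field_simp
      rw [mul_assoc, mul_div_cancel_right₀ _ (ne_of_gt h0)]

/-- The closed form of the Mellin transform of `crossKernel`. -/
def zetaProduct (s : ℂ) : ℂ :=
  1 / (8 * π) * ((-1 - s) * π ^ (s - 1) * Complex.Gamma (1 - s) *
    ((1 - 2 ^ s) * riemannZeta (-s) * ((1 - 2 ^ (s - 1)) * riemannZeta (1 - s))))

lemma mellin_crossKernel_of_re_lt {s : ℂ} (hs : s.re < -3) :
    mellin (fun y => (crossKernel y : ℂ)) s = zetaProduct s := by
  have hv : 2 < (1 - s).re := by
    rw [Complex.sub_re, Complex.one_re]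
    linarith
  set f₁ : ℝ → ℂ := fun y => (y : ℂ) ^ (1 : ℂ) • (oddLambert y : ℂ) with hf₁
  set f₂ : ℝ → ℂ := fun y => (y : ℂ) ^ (2 : ℂ) • ((deriv oddLambert y : ℝ) : ℂ) with hf₂
  have hc₁ : MellinConvergent f₁ (-s) := by
    rw [hf₁, MellinConvergent.cpow_smul]
    obtain ⟨n, hn⟩ := exists_nat_gt (-s + 1).re
    refine mellinConvergent_of_abs_le isExpSummable_oddLambert.continuousOn
      (exists_abs_lambert_le abs_oddLambertCoeff_le (le_add_right le_rfl : 3 ≤ 3 + n))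
      (exists_abs_lambert_le abs_oddLambertCoeff_le le_rfl) ?_ ?_
    · push_cast
      linarith
    · rw [Complex.add_re, Complex.neg_re, Complex.one_re]
      push_cast
      linarith
  have hc₂ : MellinConvergent f₂ (-s) := by
    rw [hf₂, MellinConvergent.cpow_smul]
    obtain ⟨n, hn⟩ := exists_nat_gt (-s + 2).re
    have hderiv : ∀ y, 0 < y → deriv oddLambert y = _ := fun y hy =>
      (isExpSummable_oddLambert.hasDerivAt hy).deriv
    have hb : ∀ m : ℕ, 4 ≤ m → ∃ C, ∀ y, 0 < y → |deriv oddLambert y| ≤ C * y ^ (-(m : ℝ)) := by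
      intro m hm
      obtain ⟨C, hC⟩ := exists_abs_lambert_mul_frequency_le abs_oddLambertCoeff_le hm
      refine ⟨π * C, fun y hy => ?_⟩
      rw [hderiv y hy, abs_mul, abs_neg, abs_of_pos Real.pi_pos, mul_assoc]
      exact mul_le_mul_of_nonneg_left (hC y hy) Real.pi_pos.le
    refine mellinConvergent_of_abs_le ?_ (hb (4 + n) (by omega)) (hb 4 le_rfl) ?_ ?_
    · exact (isExpSummable_oddLambert.mul_frequency.continuousOn.const_smul (-π)).congr
        fun y hy => hderiv y hy
    · push_cast
      linarith
    · rw [Complex.add_re, Complex.neg_re]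
      norm_num
      linarith
  have h1 : mellin (fun y => (crossKernel y : ℂ)) s =
      mellin (fun y => (1 / (8 * π) : ℂ) • (((-2 : ℂ) • f₁ y⁻¹) - f₂ y⁻¹)) s := by
    refine setIntegral_congr_fun measurableSet_Ioi fun y hy => ?_
    simp only
    congr 1
    rw [crossKernel, lambert_mul_oddLambert_inv hy]
    simp only [hf₁, hf₂, smul_eq_mul, Complex.cpow_one, Complex.cpow_ofNat]
    push_cast
    ring
  have h2 := mellin_comp_inv (fun y => (1 / (8 * π) : ℂ) • (((-2 : ℂ) • f₁ y) - f₂ y)) s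
  rw [h1, h2, mellin_const_smul, (hasMellin_sub (hc₁.const_smul (-2 : ℂ)) hc₂).2,
    mellin_const_smul, hf₁, hf₂, mellin_cpow_smul, mellin_cpow_smul,
    show -s + 1 = 1 - s by ring, show -s + 2 = (1 - s) + 1 by ring,
    mellin_oddLambert hv, mellin_deriv_oddLambert hv,
    tsum_oddLambertCoeff_div_cpow hv, zetaProduct, show 1 - s - 1 = -s by ring,
    show 1 - (1 - s) = s by ring, show -(1 - s) = s - 1 by ring]
  simp only [smul_eq_mul]
  ring

lemma differentiableAt_zetaProduct {s : ℂ} (hs : s.im ≠ 0) : DifferentiableAt ℂ zetaProduct s := by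
  have hne : ∀ x : ℝ, s ≠ x := fun x h => hs (by rw [h, Complex.ofReal_im])
  have h1 : DifferentiableAt ℂ (fun s => Complex.Gamma (1 - s)) s := by
    refine (Complex.differentiableAt_Gamma _ fun m h => hne (1 + m) ?_).comp s (by fun_prop)
    push_cast
    linear_combination -h
  have h2 : DifferentiableAt ℂ (fun s => riemannZeta (-s)) s := by
    refine (differentiableAt_riemannZeta fun h => hne (-1) ?_).comp s (by fun_prop)
    push_cast
    linear_combination -h
  have h3 : DifferentiableAt ℂ (fun s => riemannZeta (1 - s)) s := by
    refine (differentiableAt_riemannZeta fun h => hne 0 ?_).comp s (by fun_prop)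
    push_cast
    linear_combination -h
  have hpi : (π : ℂ) ≠ 0 := by exact_mod_cast Real.pi_ne_zero
  have h4 : DifferentiableAt ℂ (fun s : ℂ => (π : ℂ) ^ (s - 1)) s :=
    (differentiableAt_id.sub_const 1).const_cpow (Or.inl hpi)
  have h5 : DifferentiableAt ℂ (fun s : ℂ => (2 : ℂ) ^ s) s :=
    differentiableAt_id.const_cpow (Or.inl two_ne_zero)
  have h6 : DifferentiableAt ℂ (fun s : ℂ => (2 : ℂ) ^ (s - 1)) s :=
    (differentiableAt_id.sub_const 1).const_cpow (Or.inl two_ne_zero)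
  exact (((((differentiableAt_const _).sub differentiableAt_id).mul h4).mul h1).mul
    ((((differentiableAt_const _).sub h5).mul h2).mul
      (((differentiableAt_const _).sub h6).mul h3))).const_mul _

lemma mellin_crossKernel_eqOn {U : Set ℂ} (hU : IsOpen U) (hU' : IsPreconnected U)
    (him : ∀ s ∈ U, s.im ≠ 0) {z : ℂ} (hz : z ∈ U) (hz' : z.re < -3) :
    Set.EqOn (mellin fun y => (crossKernel y : ℂ)) zetaProduct U := by
  have h1 : AnalyticOnNhd ℂ (mellin fun y => (crossKernel y : ℂ)) U :=
    differentiable_mellin_crossKernel.differentiableOn.analyticOnNhd hU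
  have h2 : AnalyticOnNhd ℂ zetaProduct U :=
    DifferentiableOn.analyticOnNhd
      (fun s hs => (differentiableAt_zetaProduct (him s hs)).differentiableWithinAt) hU
  refine h1.eqOn_of_preconnected_of_eventuallyEq h2 hU' hz ?_
  exact Filter.eventuallyEq_of_mem ((isOpen_lt Complex.continuous_re continuous_const).mem_nhds hz')
    fun s hs => mellin_crossKernel_of_re_lt hs

/-- The Mellin transform of `crossKernel` off the real axis. -/
theorem mellin_crossKernel {s : ℂ} (hs : s.im ≠ 0) :
    mellin (fun y => (crossKernel y : ℂ)) s = zetaProduct s := by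
  rcases lt_or_gt_of_ne hs with h | h
  · refine mellin_crossKernel_eqOn (U := {s | s.im < 0})
      (isOpen_lt Complex.continuous_im continuous_const)
      (convex_halfSpace_im_lt 0).isPreconnected (fun s hs => ne_of_lt hs) (z := -4 - I) ?_ ?_ h
    · simp
    · norm_num
  · refine mellin_crossKernel_eqOn (U := {s | 0 < s.im})
      (isOpen_lt continuous_const Complex.continuous_im)
      (convex_halfSpace_im_gt 0).isPreconnected (fun s hs => ne_of_gt hs) (z := -4 + I) ?_ ?_ h
    · simp
    · norm_num

lemma mellin_crossKernel_eq_zero {ρ : ℂ} (hzero : riemannZeta ρ = 0) (hρ : ρ.im ≠ 0) :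
    mellin (fun y => (crossKernel y : ℂ)) ρ = 0 := by
  have h : riemannZeta (1 - ρ) = 0 := by
    rw [riemannZeta_one_sub, hzero, mul_zero]
    · rintro n rfl
      simp at hρ
    · rintro rfl
      simp at hρ
  rw [mellin_crossKernel hρ, zetaProduct, h]
  ring

/-- A number with a chosen divisor, as the pair of the divisor and its complement. -/
def divisorPair (p : (j : ℕ) × {d : ℕ // d ∈ j.divisors}) : ℕ × ℕ := (p.2.1, p.1 / p.2.1)

lemma divisorPair_injective : Function.Injective divisorPair := by
  rintro ⟨j, d, hd⟩ ⟨j', d', hd'⟩ h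
  simp only [divisorPair, Prod.mk.injEq] at h
  obtain ⟨rfl, h⟩ := h
  obtain rfl : j = j' := by
    rw [← Nat.mul_div_cancel' (Nat.dvd_of_mem_divisors hd), h,
      Nat.mul_div_cancel' (Nat.dvd_of_mem_divisors hd')]
  rfl

lemma mem_range_divisorPair {q : ℕ × ℕ} (hq : q.1 * q.2 ≠ 0) : q ∈ Set.range divisorPair :=
  ⟨⟨q.1 * q.2, q.1, Nat.mem_divisors.2 ⟨dvd_mul_right _ _, hq⟩⟩,
    Prod.ext rfl (Nat.mul_div_cancel_left _ (Nat.pos_of_ne_zero (left_ne_zero_of_mul hq)))⟩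

lemma hasSum_comp_divisorPair_iff {E : Type*} [NormedAddCommGroup E] {F : ℕ × ℕ → E} {S : E}
    (h0 : ∀ q, q.1 * q.2 = 0 → F q = 0) :
    HasSum (F ∘ divisorPair) S ↔ HasSum F S :=
  divisorPair_injective.hasSum_iff fun q hq => h0 q <| by
    by_contra h
    exact hq (mem_range_divisorPair h)

lemma hasSum_sum_divisors {E : Type*} [NormedAddCommGroup E] {F : ℕ × ℕ → E} {S : E}
    (h0 : ∀ q, q.1 * q.2 = 0 → F q = 0) (h : HasSum F S) :
    HasSum (fun n : ℕ => ∑ d ∈ n.divisors, F (d, n / d)) S := by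
  refine ((hasSum_comp_divisorPair_iff h0).2 h).sigma fun n => ?_
  rw [← Finset.sum_coe_sort]
  exact hasSum_fintype fun d : {d : ℕ // d ∈ n.divisors} => F (d, n / d)

lemma filter_odd_divisors {n : ℕ} (hn : n ≠ 0) :
    n.divisors.filter Odd = (ordCompl[2] n).divisors := by
  ext k
  simp only [Finset.mem_filter, Nat.mem_divisors]
  constructor
  · rintro ⟨⟨h1, -⟩, h2⟩
    refine ⟨?_, (Nat.ordCompl_pos 2 hn).ne'⟩
    rw [← Nat.ordProj_mul_ordCompl_eq_self n 2] at h1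
    exact (Nat.Coprime.pow_right _ (Nat.coprime_two_right.2 h2)).dvd_of_dvd_mul_left h1
  · rintro ⟨h1, -⟩
    refine ⟨⟨h1.trans (Nat.ordCompl_dvd n 2), hn⟩, ?_⟩
    exact Odd.of_dvd_nat (Nat.coprime_two_left.1 (Nat.coprime_ordCompl Nat.prime_two hn)) h1

lemma paperA_eq_sum (n : ℕ) : (paperA n : ℝ) = ∑ d ∈ n.divisors, lambertCoeff (d, n / d) := by
  rcases eq_or_ne n 0 with rfl | hn
  · simp [paperA]
  have h1 : ∑ d ∈ n.divisors, lambertCoeff (d, n / d) =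
      ∑ d ∈ n.divisors, if Odd d then ((n / d : ℕ) : ℝ) else 0 := by
    rw [← Nat.sum_div_divisors n fun d => if Odd d then ((n / d : ℕ) : ℝ) else 0]
    refine Finset.sum_congr rfl fun d hd => ?_
    rw [lambertCoeff, Nat.div_div_self (Nat.dvd_of_mem_divisors hd) hn]
  rw [h1, ← Finset.sum_filter, filter_odd_divisors hn, paperA, ArithmeticFunction.sigma_one_apply,
    ← Nat.sum_div_divisors, Int.cast_mul, Int.cast_pow, Int.cast_ofNat, Int.cast_natCast,
    Nat.cast_sum, Finset.mul_sum]
  refine Finset.sum_congr rfl fun d hd => ?_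
  have h2 : n / d = 2 ^ n.factorization 2 * (ordCompl[2] n / d) := by
    rw [← Nat.mul_div_assoc _ (Nat.dvd_of_mem_divisors hd), Nat.ordProj_mul_ordCompl_eq_self]
  rw [h2, Nat.cast_mul, Nat.cast_pow, Nat.cast_ofNat]

lemma paperB_eq_sum (n : ℕ) : (paperB n : ℝ) = ∑ d ∈ n.divisors, oddLambertCoeff (d, n / d) := by
  by_cases hn : Odd n
  · rw [paperB, if_pos hn, ArithmeticFunction.sigma_one_apply]
    push_cast
    refine Finset.sum_congr rfl fun d hd => ?_
    have hd := Nat.dvd_of_mem_divisors hd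
    exact (if_pos ⟨hn.of_dvd_nat hd, hn.of_dvd_nat (Nat.div_dvd_of_dvd hd)⟩).symm
  · rw [paperB, if_neg hn, Int.cast_zero]
    refine (Finset.sum_eq_zero fun d hd => if_neg fun h => hn ?_).symm
    rw [← Nat.mul_div_cancel' (Nat.dvd_of_mem_divisors hd)]
    exact h.1.mul h.2

lemma hasSum_exp_of_eq_sum_divisors {a : ℕ × ℕ → ℝ}
    (ha : ∀ q, |a q| ≤ if 0 < q.1 ∧ 0 < q.2 then (q.1 : ℝ) else 0)
    (hs : IsExpSummable a fun q : ℕ × ℕ => (q.1 : ℝ) * q.2) {c : ℕ → ℤ}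
    (hc : ∀ n, (c n : ℝ) = ∑ d ∈ n.divisors, a (d, n / d)) {y : ℝ} (hy : 0 < y) :
    HasSum (fun n : ℕ => c n * rexp (-π * n * y)) (expSeries a (fun q => (q.1 : ℝ) * q.2) y) := by
  refine (hasSum_sum_divisors (fun q hq => ?_) (hs.hasSum hy)).congr_fun fun n => ?_
  · rcases lambertCoeff_eq_zero_or_pos ha q with h | h
    · rw [h, zero_mul]
    · exact absurd (by exact_mod_cast hq) h.ne'
  · rw [hc, Finset.sum_mul]
    refine Finset.sum_congr rfl fun d hd => ?_
    have : ((d : ℝ)) * ((n / d : ℕ) : ℝ) = n := by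
      exact_mod_cast Nat.mul_div_cancel' (Nat.dvd_of_mem_divisors hd)
    rw [this]

lemma paperA_nonneg (n : ℕ) : (0 : ℝ) ≤ paperA n := by
  unfold paperA
  positivity

lemma paperB_nonneg (n : ℕ) : (0 : ℝ) ≤ paperB n := by
  unfold paperB
  split_ifs <;> positivity

/-- The terms of the double series for `crossKernel`. -/
def crossTerm (q : ℕ × ℕ) (y : ℝ) : ℝ :=
  paperA q.1 * rexp (-π * q.1 * y) * (paperB q.2 * rexp (-π * q.2 * y⁻¹))

lemma crossTerm_nonneg (q : ℕ × ℕ) (y : ℝ) : 0 ≤ crossTerm q y :=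
  mul_nonneg (mul_nonneg (paperA_nonneg _) (Real.exp_pos _).le)
    (mul_nonneg (paperB_nonneg _) (Real.exp_pos _).le)

lemma continuousOn_crossTerm (q : ℕ × ℕ) : ContinuousOn (crossTerm q) (Set.Ioi 0) := by
  have h : ContinuousOn (fun y : ℝ => y⁻¹) (Set.Ioi 0) :=
    continuousOn_inv₀.mono fun _ hy => ne_of_gt hy
  unfold crossTerm
  fun_prop

lemma hasSum_crossTerm {y : ℝ} (hy : 0 < y) :
    HasSum (fun q => crossTerm q y) (crossKernel y) := by
  have h1 : HasSum _ (lambert y) :=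
    hasSum_exp_of_eq_sum_divisors abs_lambertCoeff_le isExpSummable_lambert paperA_eq_sum hy
  have h2 : HasSum _ (oddLambert y⁻¹) := hasSum_exp_of_eq_sum_divisors abs_oddLambertCoeff_le
    isExpSummable_oddLambert paperB_eq_sum (inv_pos.2 hy)
  exact h1.mul h2 (h1.summable.mul_of_nonneg h2.summable
    (fun n => mul_nonneg (paperA_nonneg n) (Real.exp_pos _).le)
    (fun n => mul_nonneg (paperB_nonneg n) (Real.exp_pos _).le))

/-- Mellin transforms of sums of nonnegative functions can be computed termwise. -/
lemma hasSum_mellin_of_nonneg {ι : Type*} [Countable ι] {f : ι → ℝ → ℝ} {F : ℝ → ℝ} {s : ℂ}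
    (hf : ∀ i, ContinuousOn (f i) (Set.Ioi 0)) (hf0 : ∀ i y, 0 ≤ f i y)
    (hF : ∀ y, 0 < y → HasSum (fun i => f i y) (F y))
    (hs : MellinConvergent (fun y => (F y : ℂ)) s) :
    HasSum (fun i => mellin (fun y => (f i y : ℂ)) s) (mellin (fun y => (F y : ℂ)) s) := by
  have hmeas : ∀ i, AEStronglyMeasurable (fun y : ℝ => (y : ℂ) ^ (s - 1) • (f i y : ℂ))
      (volume.restrict (Set.Ioi 0)) := fun i => by
    refine ContinuousOn.aestronglyMeasurable (fun y hy => ?_) measurableSet_Ioi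
    have h1 : ContinuousAt (fun y : ℝ => (y : ℂ) ^ (s - 1)) y :=
      continuousAt_ofReal_cpow_const _ _ (Or.inr (ne_of_gt hy))
    exact h1.continuousWithinAt.smul
      (Complex.continuous_ofReal.continuousAt.comp_continuousWithinAt (hf i y hy))
  have hnorm : ∀ (y : ℝ) (x : ℝ), 0 ≤ x →
      ‖(y : ℂ) ^ (s - 1) • (x : ℂ)‖ = ‖(y : ℂ) ^ (s - 1)‖ * x := fun y x hx => by
    rw [norm_smul, Complex.norm_real, Real.norm_of_nonneg hx]
  have hF0 : ∀ y, 0 < y → 0 ≤ F y := fun y hy => (hF y hy).nonneg fun i => hf0 i y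
  have hint : ∀ i, IntegrableOn (fun y : ℝ => (y : ℂ) ^ (s - 1) • (f i y : ℂ)) (Set.Ioi 0) := by
    refine fun i => Integrable.mono hs (hmeas i) ?_
    filter_upwards [ae_restrict_mem measurableSet_Ioi] with y hy
    rw [hnorm _ _ (hf0 i y), hnorm _ _ (hF0 y hy)]
    exact mul_le_mul_of_nonneg_left (le_hasSum (hF y hy) i fun j _ => hf0 j y) (norm_nonneg _)
  have hsum : Summable fun i => ∫ y in Set.Ioi (0 : ℝ), ‖(y : ℂ) ^ (s - 1) • (f i y : ℂ)‖ := by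
    refine summable_of_sum_le (c := ∫ y in Set.Ioi (0 : ℝ), ‖(y : ℂ) ^ (s - 1) • (F y : ℂ)‖)
      (fun i => integral_nonneg fun y => norm_nonneg _) fun u => ?_
    rw [← integral_finsetSum _ fun i _ => (hint i).norm]
    refine setIntegral_mono_on (integrable_finsetSum _ fun i _ => (hint i).norm) hs.norm
      measurableSet_Ioi fun y hy => ?_
    simp only [hnorm _ _ (hf0 _ y), hnorm _ _ (hF0 y hy), ← Finset.mul_sum]
    exact mul_le_mul_of_nonneg_left (sum_le_hasSum u (fun j _ => hf0 j y) (hF y hy))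
      (norm_nonneg _)
  have h := hasSum_integral_of_summable_integral_norm hint hsum
  have h2 : mellin (fun y => (F y : ℂ)) s =
      ∫ y in Set.Ioi (0 : ℝ), ∑' i, (y : ℂ) ^ (s - 1) • (f i y : ℂ) := by
    refine setIntegral_congr_fun measurableSet_Ioi fun y hy => ?_
    exact ((Complex.hasSum_ofReal.2 (hF y hy)).const_smul ((y : ℂ) ^ (s - 1))).tsum_eq.symm
  rw [h2]
  exact h

lemma mellin_exp_mul_exp_inv {a b : ℝ} (ha : 0 < a) (hb : 0 < b) (s : ℂ) :
    mellin (fun y => ((rexp (-π * a * y) * rexp (-π * b * y⁻¹) : ℝ) : ℂ)) s =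
      2 * ((b / a : ℝ) : ℂ) ^ (s / 2) * besselK s (2 * π * √(a * b)) := by
  set r := √(b / a) with hr
  have hr0 : 0 < r := Real.sqrt_pos.2 (div_pos hb ha)
  have hrr : r * r = b / a := Real.mul_self_sqrt (div_pos hb ha).le
  have h1 := mellin_comp_mul_left
    (fun y => ((rexp (-π * a * y) * rexp (-π * b * y⁻¹) : ℝ) : ℂ)) s hr0
  have h2 : mellin (fun t => ((rexp (-π * a * (r * t)) * rexp (-π * b * (r * t)⁻¹) : ℝ) : ℂ)) s =
      2 * besselK s (2 * π * √(a * b)) := by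
    rw [besselK, ← mul_assoc, mul_one_div_cancel two_ne_zero, one_mul]
    refine setIntegral_congr_fun measurableSet_Ioi fun t ht => ?_
    have ht0 : t ≠ 0 := ne_of_gt ht
    have h3 : √(a * b) = a * r := by
      rw [show a * b = (a * r) * (a * r) by
        rw [mul_mul_mul_comm, hrr]; field_simp, Real.sqrt_mul_self (mul_pos ha hr0).le]
    have h4 : b = a * r * r := by
      rw [mul_assoc, hrr]
      field_simp
    beta_reduce
    rw [smul_eq_mul, ← Real.exp_add, Complex.ofReal_exp]
    congr 2
    rw [h3]
    have h5 : -π * a * (r * t) + -π * b * (r * t)⁻¹ = -(2 * π * (a * r) / 2) * (t + 1 / t) := by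
      rw [h4]
      field_simp
      ring
    rw [h5]
    push_cast
    rfl
  have h3 : ((b / a : ℝ) : ℂ) ^ (s / 2) = (r : ℂ) ^ s := by
    have hr1 : (r : ℂ) ≠ 0 := by exact_mod_cast hr0.ne'
    rw [← hrr, Complex.ofReal_mul, Complex.mul_cpow_ofReal_nonneg hr0.le hr0.le,
      ← Complex.cpow_add _ _ hr1, add_halves]
  have h4 : (r : ℂ) ^ s * (r : ℂ) ^ (-s) = 1 := by
    have hr1 : (r : ℂ) ≠ 0 := by exact_mod_cast hr0.ne'
    rw [← Complex.cpow_add _ _ hr1, add_neg_cancel, Complex.cpow_zero]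
  rw [h2, smul_eq_mul] at h1
  rw [h3]
  linear_combination (-(r : ℂ) ^ s) * h1 -
    mellin (fun y => ((rexp (-π * a * y) * rexp (-π * b * y⁻¹) : ℝ) : ℂ)) s * h4

lemma seriesTerm_mul_self_eq_zero {q : ℕ × ℕ} (hq : q.1 * q.2 = 0) (s : ℂ) :
    seriesTerm s (q.1 * q.2) q.1 = 0 := by
  rcases mul_eq_zero.1 hq with h | h
  · simp [seriesTerm, paperA, h]
  · simp [seriesTerm, paperB, h]

lemma seriesTerm_mul_self (s : ℂ) (q : ℕ × ℕ) :
    seriesTerm s (q.1 * q.2) q.1 = 1 / 2 * mellin (fun y => (crossTerm q y : ℂ)) s := by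
  by_cases hq : q.1 * q.2 = 0
  · rw [seriesTerm_mul_self_eq_zero hq]
    have h : crossTerm q = 0 := by
      ext y
      rcases mul_eq_zero.1 hq with h | h
      · simp [crossTerm, paperA, h]
      · simp [crossTerm, paperB, h]
    simp [h, mellin]
  · obtain ⟨d, m⟩ := q
    have hd : 0 < d := Nat.pos_of_ne_zero (left_ne_zero_of_mul hq)
    have hm : 0 < m := Nat.pos_of_ne_zero (right_ne_zero_of_mul hq)
    have h1 : (fun y => (crossTerm (d, m) y : ℂ)) = fun y => ((paperA d : ℂ) * paperB m) •
        ((rexp (-π * d * y) * rexp (-π * m * y⁻¹) : ℝ) : ℂ) := by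
      ext y
      rw [crossTerm, smul_eq_mul]
      push_cast
      ring
    have h2 : ((d * m : ℕ) : ℂ) / (d : ℂ) ^ 2 = ((m / d : ℝ) : ℂ) := by
      have : (d : ℂ) ≠ 0 := by exact_mod_cast hd.ne'
      push_cast
      field_simp
    rw [h1, mellin_const_smul, mellin_exp_mul_exp_inv (by exact_mod_cast hd) (by exact_mod_cast hm),
      seriesTerm, Nat.mul_div_cancel_left _ hd, h2, smul_eq_mul]
    push_cast
    ring

theorem vanishing_at_zeta_zeros (ρ : ℂ) (hzero : riemannZeta ρ = 0)
    (hnonreal : ρ.im ≠ 0) (hlow : 0 < ρ.re) (hup : ρ.re < 1) :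
    Summable (fun p : (j : ℕ) × {d : ℕ // d ∈ j.divisors} => ‖seriesTerm ρ p.1 p.2.1‖) ∧
    ∑' j : ℕ, ∑ d ∈ j.divisors, seriesTerm ρ j d = 0 := by
  have h1 : HasSum (fun q : ℕ × ℕ => seriesTerm ρ (q.1 * q.2) q.1) 0 := by
    simp only [seriesTerm_mul_self]
    have h := (hasSum_mellin_of_nonneg continuousOn_crossTerm crossTerm_nonneg
      (fun y hy => hasSum_crossTerm hy) (mellinConvergent_crossKernel ρ)).mul_left (1 / 2)
    rwa [mellin_crossKernel_eq_zero hzero hnonreal, mul_zero] at h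
  have h0 : ∀ q : ℕ × ℕ, q.1 * q.2 = 0 → seriesTerm ρ (q.1 * q.2) q.1 = 0 :=
    fun q hq => seriesTerm_mul_self_eq_zero hq ρ
  constructor
  · refine ((hasSum_comp_divisorPair_iff h0).2 h1).summable.norm.congr ?_
    rintro ⟨j, d, hd⟩
    simp only [Function.comp_apply, divisorPair, Nat.mul_div_cancel' (Nat.dvd_of_mem_divisors hd)]
  · refine ((hasSum_sum_divisors h0 h1).congr_fun fun j => ?_).tsum_eq
    refine Finset.sum_congr rfl fun d hd => ?_
    simp only [Nat.mul_div_cancel' (Nat.dvd_of_mem_divisors hd)]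
end
end

section
/- There exists a constant C > 0 such that for every complex w with Re(w) ≥ 1/4 and every positive integer N, |Γ'(w)/Γ(w) − log N + Σ_{n=0}^{N} 1/(n + w)| ≤ C (1 + |w|)/N, where Γ'/Γ is the logarithmic derivative of the Gamma function. -/
open Filter Topology in
/-- A bound on the distance from the `N`-th term to all later terms passes to the limit. -/
theorem norm_sub_le_of_tendsto_of_forall_ge {u : ℕ → ℂ} {l : ℂ} {b : ℝ} {N : ℕ}
    (hu : Tendsto u atTop (𝓝 l)) (h : ∀ M ≥ N, ‖u M - u N‖ ≤ b) : ‖l - u N‖ ≤ b :=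
  le_of_tendsto (hu.sub_const (u N)).norm (eventually_atTop.2 ⟨N, h⟩)

namespace Complex

open Filter Topology Metric

/-- The logarithmic derivative of `GammaSeq · N` at `w`. -/
noncomputable def digammaSeq (N : ℕ) (w : ℂ) : ℂ :=
  (Real.log N : ℂ) - ∑ n ∈ Finset.range (N + 1), 1 / ((n : ℂ) + w)

/-- A logarithm of `GammaSeq · N` on the right half-plane. -/
noncomputable def logGammaSeq (N : ℕ) (w : ℂ) : ℂ :=
  (Real.log N : ℂ) * w + (Real.log N.factorial : ℂ) -
    ∑ n ∈ Finset.range (N + 1), log ((n : ℂ) + w)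

theorem natCast_add_ne_zero_of_re_pos {w : ℂ} (hw : 0 < w.re) (n : ℕ) : (n : ℂ) + w ≠ 0 := by
  intro h
  have := congrArg re h
  simp only [add_re, natCast_re, zero_re] at this
  have : (0 : ℝ) ≤ n := n.cast_nonneg
  linarith

theorem hasDerivAt_logGammaSeq (N : ℕ) {w : ℂ} (hw : 0 < w.re) :
    HasDerivAt (logGammaSeq N) (digammaSeq N w) w := by
  have hsum : HasDerivAt (fun z : ℂ ↦ ∑ n ∈ Finset.range (N + 1), log ((n : ℂ) + z))
      (∑ n ∈ Finset.range (N + 1), 1 / ((n : ℂ) + w)) w := by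
    refine HasDerivAt.fun_sum fun n _ ↦ ?_
    refine ((hasDerivAt_id w).const_add (n : ℂ)).clog (Or.inl ?_)
    simp only [id, add_re, natCast_re]
    positivity
  have hlin : HasDerivAt (fun z : ℂ ↦ (Real.log N : ℂ) * z + (Real.log N.factorial : ℂ))
      (Real.log N : ℂ) w := by
    simpa using ((hasDerivAt_id w).const_mul (Real.log N : ℂ)).add_const
      (Real.log N.factorial : ℂ)
  exact hlin.sub hsum

theorem exp_logGammaSeq {N : ℕ} (hN : N ≠ 0) {w : ℂ} (hw : 0 < w.re) :
    exp (logGammaSeq N w) = GammaSeq w N := by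
  have hfact : exp (Real.log N.factorial : ℂ) = N.factorial := by
    rw [← ofReal_exp, Real.exp_log (by positivity), ofReal_natCast]
  rw [logGammaSeq, exp_sub, exp_add, exp_sum, hfact, GammaSeq,
    cpow_def_of_ne_zero (Nat.cast_ne_zero.2 hN), natCast_log]
  congr 1
  refine Finset.prod_congr rfl fun n _ ↦ ?_
  rw [exp_log (natCast_add_ne_zero_of_re_pos hw n), add_comm]

theorem norm_digammaSeq_succ_sub_le {N : ℕ} (hN : 0 < N) {w : ℂ} (hw : 0 < w.re) :
    ‖digammaSeq (N + 1) w - digammaSeq N w‖ ≤ (1 + ‖w‖) * (1 / N - 1 / ((N + 1 : ℕ) : ℝ)) := by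
  have hN' : (0 : ℝ) < N := by exact_mod_cast hN
  set d : ℝ := Real.log ((N + 1 : ℕ) : ℝ) - Real.log N with hd
  have hlog : d = Real.log (((N + 1 : ℕ) : ℝ) / N) := by
    rw [Real.log_div (by positivity) hN'.ne']
  have hupper : d ≤ 1 / N := by
    rw [hlog]
    refine (Real.log_le_sub_one_of_pos (by positivity)).trans (le_of_eq ?_)
    push_cast
    field_simp
    ring
  have hlower : 1 / ((N + 1 : ℕ) : ℝ) ≤ d := by
    rw [hlog]
    refine le_trans (le_of_eq ?_) (Real.one_sub_inv_le_log_of_pos (by positivity))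
    push_cast
    field_simp
    ring
  have hne : ((N + 1 : ℕ) : ℂ) ≠ 0 := Nat.cast_ne_zero.2 N.succ_ne_zero
  have hne' := natCast_add_ne_zero_of_re_pos hw (N + 1)
  have hsplit : digammaSeq (N + 1) w - digammaSeq N w =
      ((d - 1 / ((N + 1 : ℕ) : ℝ) : ℝ) : ℂ) +
        w / (((N + 1 : ℕ) : ℂ) * (((N + 1 : ℕ) : ℂ) + w)) := by
    have : w / (((N + 1 : ℕ) : ℂ) * (((N + 1 : ℕ) : ℂ) + w)) =
        1 / ((N + 1 : ℕ) : ℂ) - 1 / (((N + 1 : ℕ) : ℂ) + w) := by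
      field_simp
      ring
    rw [this, digammaSeq, digammaSeq, Finset.sum_range_succ _ (N + 1), hd]
    simp only [ofReal_sub, ofReal_div, ofReal_one, ofReal_natCast]
    ring
  have hfirst : ‖((d - 1 / ((N + 1 : ℕ) : ℝ) : ℝ) : ℂ)‖ ≤ 1 / N - 1 / ((N + 1 : ℕ) : ℝ) := by
    rw [norm_real, Real.norm_of_nonneg (by linarith)]
    linarith
  have hge : (N : ℝ) ≤ ‖((N + 1 : ℕ) : ℂ) + w‖ := by
    refine le_trans ?_ (re_le_norm _)
    simp only [add_re, natCast_re]
    push_cast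
    linarith
  have hsecond : ‖w / (((N + 1 : ℕ) : ℂ) * (((N + 1 : ℕ) : ℂ) + w))‖ ≤
      ‖w‖ * (1 / N - 1 / ((N + 1 : ℕ) : ℝ)) := by
    have : ‖w‖ * (1 / N - 1 / ((N + 1 : ℕ) : ℝ)) = ‖w‖ / (((N + 1 : ℕ) : ℝ) * N) := by
      push_cast
      field_simp
      ring
    rw [this, norm_div, norm_mul, norm_natCast]
    gcongr
  rw [hsplit, one_add_mul]
  exact (norm_add_le _ _).trans (add_le_add hfirst hsecond)

theorem norm_digammaSeq_sub_le {N M : ℕ} (hN : 0 < N) (hM : N ≤ M) {w : ℂ} (hw : 0 < w.re) :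
    ‖digammaSeq M w - digammaSeq N w‖ ≤ (1 + ‖w‖) / N := by
  have key : ‖digammaSeq M w - digammaSeq N w‖ ≤ (1 + ‖w‖) * (1 / N - 1 / (M : ℝ)) := by
    induction M, hM using Nat.le_induction with
    | base => simp
    | succ M hM ih =>
      have := norm_digammaSeq_succ_sub_le (hN.trans_le hM) hw
      have := norm_sub_le_norm_sub_add_norm_sub (digammaSeq (M + 1) w) (digammaSeq M w)
        (digammaSeq N w)
      linarith
  refine key.trans ?_
  rw [div_eq_mul_one_div (1 + ‖w‖)]
  gcongr
  have : (0 : ℝ) ≤ 1 / (M : ℝ) := by positivity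
  linarith

theorem uniformCauchySeqOn_digammaSeq {s : Set ℂ} {B : ℝ} (hre : ∀ z ∈ s, 0 < z.re)
    (hB : ∀ z ∈ s, ‖z‖ ≤ B) : UniformCauchySeqOn digammaSeq atTop s := by
  rw [Metric.uniformCauchySeqOn_iff]
  intro ε hε
  obtain ⟨N, hN⟩ := exists_nat_gt (2 * (1 + B) / ε)
  refine ⟨N + 1, fun m hm n hn z hz ↦ ?_⟩
  have hN1 : (0 : ℝ) < ((N + 1 : ℕ) : ℝ) := by positivity
  have hlt : 2 * ((1 + ‖z‖) / ((N + 1 : ℕ) : ℝ)) < ε := by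
    have h1 : 2 * (1 + B) < ε * ((N + 1 : ℕ) : ℝ) := by
      rw [div_lt_iff₀ hε] at hN
      push_cast
      nlinarith
    rw [← mul_div_assoc, div_lt_iff₀ hN1]
    linarith [hB z hz]
  have h1 := norm_digammaSeq_sub_le N.succ_pos hm (hre z hz)
  have h2 := norm_digammaSeq_sub_le N.succ_pos hn (hre z hz)
  rw [← dist_eq_norm] at h1 h2
  have h3 := dist_triangle_right (digammaSeq m z) (digammaSeq n z) (digammaSeq (N + 1) z)
  linarith

theorem tendsto_digammaSeq {w : ℂ} (hw : 0 < w.re) :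
    Tendsto (fun N ↦ digammaSeq N w) atTop (𝓝 (deriv Gamma w / Gamma w)) := by
  obtain ⟨c, hc, hwc⟩ : ∃ c : ℝ, 0 < c ∧ w ∈ ball (c : ℂ) c := by
    refine ⟨‖w‖ ^ 2 / w.re + 1, by positivity, ?_⟩
    set c : ℝ := ‖w‖ ^ 2 / w.re + 1 with hc
    have hc0 : 0 < c := by positivity
    have hcw : c * w.re = ‖w‖ ^ 2 + w.re := by
      rw [hc]
      field_simp
    rw [mem_ball, dist_eq_norm]
    refine lt_of_pow_lt_pow_left₀ 2 hc0.le ?_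
    have h1 : ‖w - c‖ ^ 2 = (w.re - c) ^ 2 + w.im ^ 2 := by
      rw [← normSq_eq_norm_sq, normSq_apply]
      simp
      ring
    have h2 : ‖w‖ ^ 2 = w.re ^ 2 + w.im ^ 2 := by
      rw [← normSq_eq_norm_sq, normSq_apply]
      ring
    nlinarith [sq_nonneg w.re, sq_nonneg w.im]
  have hcre : 0 < (c : ℂ).re := by simpa using hc
  set s := ball (c : ℂ) c with hs
  have hre : ∀ z ∈ s, 0 < z.re := by
    intro z hz
    rw [hs, mem_ball', dist_eq_norm] at hz
    have := (re_le_norm ((c : ℂ) - z)).trans_lt hz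
    simp only [sub_re, ofReal_re] at this
    linarith
  have hB : ∀ z ∈ s, ‖z‖ ≤ c + c := by
    intro z hz
    rw [hs, mem_ball, dist_eq_norm] at hz
    have h1 := norm_le_norm_sub_add z (c : ℂ)
    rw [norm_real, Real.norm_of_nonneg hc.le] at h1
    linarith
  have hder : ∀ N : ℕ, ∀ z ∈ s,
      HasDerivAt (fun z ↦ logGammaSeq N z - logGammaSeq N c) (digammaSeq N z) z :=
    fun N z hz ↦ (hasDerivAt_logGammaSeq N (hre z hz)).sub_const _
  have hcauchy' : UniformCauchySeqOn digammaSeq atTop s := uniformCauchySeqOn_digammaSeq hre hB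
  have hcauchy : UniformCauchySeqOn (fun N z ↦ logGammaSeq N z - logGammaSeq N c) atTop s := by
    refine uniformCauchySeqOn_ball_of_deriv hcauchy' hder ?_
    simp only [sub_self]
    exact tendsto_const_nhds.cauchy_map
  have hlim' : ∀ z ∈ s, ∃ l, Tendsto (fun N ↦ digammaSeq N z) atTop (𝓝 l) :=
    fun z hz ↦ cauchySeq_tendsto_of_complete (hcauchy'.cauchySeq hz)
  have hlim : ∀ z ∈ s, ∃ l, Tendsto (fun N ↦ logGammaSeq N z - logGammaSeq N c) atTop (𝓝 l) :=
    fun z hz ↦ cauchySeq_tendsto_of_complete (hcauchy.cauchySeq hz)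
  choose! g' hg' using hlim'
  choose! g hg using hlim
  have hgder : HasDerivAt g (g' w) w :=
    hasDerivAt_of_tendstoUniformlyOn isOpen_ball (hcauchy'.tendstoUniformlyOn_of_tendsto hg')
      (Eventually.of_forall hder) hg hwc
  have hexp : ∀ z ∈ s, Gamma z = Gamma c * exp (g z) := by
    intro z hz
    have h1 : Tendsto (fun N ↦ GammaSeq z N / GammaSeq c N) atTop (𝓝 (exp (g z))) := by
      refine ((continuous_exp.tendsto _).comp (hg z hz)).congr' ?_
      filter_upwards [eventually_ne_atTop 0] with N hN
      rw [Function.comp_apply, exp_sub, exp_logGammaSeq hN (hre z hz), exp_logGammaSeq hN hcre]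
    have h2 := (GammaSeq_tendsto_Gamma z).div (GammaSeq_tendsto_Gamma c)
      (Gamma_ne_zero_of_re_pos hcre)
    rw [← tendsto_nhds_unique h2 h1, mul_div_cancel₀ _ (Gamma_ne_zero_of_re_pos hcre)]
  have hΓ : HasDerivAt Gamma (Gamma c * (exp (g w) * g' w)) w :=
    (hgder.cexp.const_mul (Gamma c)).congr_of_eventuallyEq
      (eventually_of_mem (isOpen_ball.mem_nhds hwc) hexp)
  have hval : deriv Gamma w / Gamma w = g' w := by
    rw [hΓ.deriv, ← mul_assoc, ← hexp w hwc,
      mul_div_cancel_left₀ _ (Gamma_ne_zero_of_re_pos hw)]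
  rw [hval]
  exact hg' w hwc

end Complex

open scoped Real
open Real Complex

theorem digamma_asymptotic :
    ∃ C : ℝ, 0 < C ∧ ∀ w : ℂ, 1 / 4 ≤ w.re → ∀ N : ℕ, 0 < N →
      ‖deriv Complex.Gamma w / Complex.Gamma w - (Real.log N : ℂ) +
          ∑ n ∈ Finset.range (N + 1), 1 / ((n : ℂ) + w)‖ ≤
        C * (1 + ‖w‖) / N := by
  refine ⟨1, one_pos, fun w hw N hN ↦ ?_⟩
  have hw0 : 0 < w.re := by linarith
  have h := norm_sub_le_of_tendsto_of_forall_ge (tendsto_digammaSeq hw0)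
    fun M hM ↦ norm_digammaSeq_sub_le hN hM hw0
  rwa [digammaSeq, ← sub_add, ← one_mul (1 + ‖w‖)] at h
end

section
/- The modular lambda function satisfies λ(i) = 1/2; that is, (Σ_{n∈ℤ} e^{−π(n+1/2)²})⁴ = (1/2) (Σ_{n∈ℤ} e^{−π n²})⁴. -/
open scoped Real
open Real

/-- The integer lattice is the disjoint union of the two cosets of the sublattice
`{(m, n) | m + n even}`, each parametrized by `ℤ × ℤ`. -/
noncomputable def intProdSumEquiv : (ℤ × ℤ) ⊕ (ℤ × ℤ) ≃ ℤ × ℤ :=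
  Equiv.ofBijective
    (Sum.elim (fun p => (p.1 + p.2, p.1 - p.2)) (fun p => (p.1 + p.2 + 1, p.1 - p.2))) <| by
    constructor
    · rintro (⟨a, b⟩ | ⟨a, b⟩) (⟨c, d⟩ | ⟨c, d⟩) h <;>
        simp only [Sum.elim_inl, Sum.elim_inr, Prod.mk.injEq, Sum.inl.injEq, Sum.inr.injEq,
          reduceCtorEq] at h ⊢ <;> omega
    · rintro ⟨m, n⟩
      rcases Int.emod_two_eq_zero_or_one (m + n) with h | h
      · exact ⟨Sum.inl ((m + n) / 2, (m - n) / 2), by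
          simp only [Sum.elim_inl, Prod.mk.injEq]; omega⟩
      · exact ⟨Sum.inr ((m + n - 1) / 2, (m - n - 1) / 2), by
          simp only [Sum.elim_inr, Prod.mk.injEq]; omega⟩

lemma tsum_int_prod_eq_add {G : ℤ × ℤ → ℝ} (hG : Summable G) :
    ∑' p, G p = ∑' p : ℤ × ℤ, G (p.1 + p.2, p.1 - p.2) +
      ∑' p : ℤ × ℤ, G (p.1 + p.2 + 1, p.1 - p.2) := by
  have h := intProdSumEquiv.summable_iff.mpr hG
  rw [← intProdSumEquiv.tsum_eq G]
  exact Summable.tsum_sum (h.comp_injective Sum.inl_injective)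
    (h.comp_injective Sum.inr_injective)

lemma tsum_sq_eq_add {f g g' h h' : ℤ → ℝ} (hf : Summable f) (hg : Summable g)
    (hg' : Summable g') (hh : Summable h) (hh' : Summable h')
    (hfg : ∀ k l, f (k + l) * f (k - l) = g k * g' l)
    (hfh : ∀ k l, f (k + l + 1) * f (k - l) = h k * h' l) :
    (∑' n, f n) ^ 2 = (∑' n, g n) * ∑' n, g' n + (∑' n, h n) * ∑' n, h' n := by
  rw [sq, tsum_mul_tsum_of_summable_norm hf.norm hf.norm,
    tsum_mul_tsum_of_summable_norm hg.norm hg'.norm,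
    tsum_mul_tsum_of_summable_norm hh.norm hh'.norm,
    tsum_int_prod_eq_add (summable_mul_of_summable_norm hf.norm hf.norm)]
  simp only [hfg, hfh]

lemma summable_exp_neg_mul_int_add_sq (a : ℝ) {t : ℝ} (ht : 0 < t) :
    Summable fun n : ℤ => Real.exp (-(π * t * ((n : ℝ) + a) ^ 2)) := by
  refine (HurwitzKernelBounds.summable_f_int 0 a ht).congr fun n => ?_
  simp only [HurwitzKernelBounds.f_int, pow_zero, one_mul]
  ring_nf

lemma tsum_neg_one_zpow_mul_exp_eq :
    ∑' n : ℤ, (-1 : ℝ) ^ n * Real.exp (-(π * 1 * ((n : ℝ) + 0) ^ 2)) =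
      ∑' n : ℤ, Real.exp (-(π * 1 * ((n : ℝ) + 1 / 2) ^ 2)) := by
  have h := Complex.tsum_exp_neg_quadratic (a := 1) (by simp) (-Complex.I / 2)
  rw [Complex.one_cpow, div_one, one_mul] at h
  apply Complex.ofReal_injective
  rw [Complex.ofReal_tsum, Complex.ofReal_tsum]
  convert h using 1
  · refine tsum_congr fun n => ?_
    rw [Complex.exp_add]
    have : Complex.exp (2 * π * (-Complex.I / 2) * n) = (-1) ^ n := by
      rw [show (2 * π * (-Complex.I / 2) * n : ℂ) = n * -(π * Complex.I) by ring,
        Complex.exp_int_mul, Complex.exp_neg, Complex.exp_pi_mul_I]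
      norm_num
    rw [this]
    push_cast
    rw [mul_comm]
    congr 2
    ring
  · refine tsum_congr fun n => ?_
    push_cast
    congr 1
    linear_combination (-π * (n : ℂ) + π * (Complex.I ^ 2 - 1) / 4) * Complex.I_sq

/-- Jacobi's identity `θ₃⁴ = θ₂⁴ + θ₄⁴` on the imaginary axis. -/
lemma jacobi_tsum_pow_four {t : ℝ} (ht : 0 < t) :
    (∑' n : ℤ, Real.exp (-(π * t * ((n : ℝ) + 0) ^ 2))) ^ 4 =
      (∑' n : ℤ, Real.exp (-(π * t * ((n : ℝ) + 1 / 2) ^ 2))) ^ 4 +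
      (∑' n : ℤ, (-1 : ℝ) ^ n * Real.exp (-(π * t * ((n : ℝ) + 0) ^ 2))) ^ 4 := by
  have s3 := summable_exp_neg_mul_int_add_sq 0 ht
  have s2 := summable_exp_neg_mul_int_add_sq (1 / 2) ht
  have s4 : Summable fun n : ℤ => (-1 : ℝ) ^ n * Real.exp (-(π * t * ((n : ℝ) + 0) ^ 2)) :=
    Summable.of_norm <| s3.congr fun n => by simp [abs_of_pos (Real.exp_pos _)]
  have ht2 : 0 < 2 * t := by positivity
  have sA := summable_exp_neg_mul_int_add_sq 0 ht2
  have sB := summable_exp_neg_mul_int_add_sq (1 / 2) ht2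
  have sA' := (Equiv.addRight (1 : ℤ)).summable_iff.mpr sA
  have eA' := (Equiv.addRight (1 : ℤ)).tsum_eq
    fun n : ℤ => Real.exp (-(π * (2 * t) * ((n : ℝ) + 0) ^ 2))
  have sign_even (k l : ℤ) : (-1 : ℝ) ^ (k + l) * (-1) ^ (k - l) = 1 := by
    rw [← zpow_add₀ (by norm_num)]
    exact Even.neg_one_zpow ⟨k, by ring⟩
  have sign_odd (k l : ℤ) : (-1 : ℝ) ^ (k + l + 1) * (-1) ^ (k - l) = -1 := by
    rw [← zpow_add₀ (by norm_num)]
    exact Odd.neg_one_zpow ⟨k, by ring⟩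
  have h3 := tsum_sq_eq_add s3 sA sA sB sB
    (fun k l => by simp only [← Real.exp_add]; push_cast; ring_nf)
    (fun k l => by simp only [← Real.exp_add]; push_cast; ring_nf)
  have h2 := tsum_sq_eq_add s2 sB sA sA' sB
    (fun k l => by simp only [← Real.exp_add]; push_cast; ring_nf)
    (fun k l => by
      simp only [← Real.exp_add, Function.comp_apply, Equiv.coe_addRight]; push_cast; ring_nf)
  have h4 := tsum_sq_eq_add s4 sA sA sB.neg sB
    (fun k l => by
      rw [mul_mul_mul_comm, sign_even]; simp only [← Real.exp_add]; push_cast; ring_nf)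
    (fun k l => by
      rw [mul_mul_mul_comm, sign_odd, neg_mul, neg_mul]
      simp only [← Real.exp_add]; push_cast; ring_nf)
  simp only [Function.comp_def] at h2
  rw [eA'] at h2
  rw [tsum_neg] at h4
  rw [show 4 = 2 * 2 from rfl, pow_mul, pow_mul, pow_mul, h2, h3, h4]
  ring

theorem lambda_at_i :
    (∑' n : ℤ, Real.exp (-(π * ((n : ℝ) + 1 / 2) ^ 2))) ^ 4 =
      (1 / 2) * (∑' n : ℤ, Real.exp (-(π * (n : ℝ) ^ 2))) ^ 4 := by
  have h := jacobi_tsum_pow_four one_pos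
  rw [tsum_neg_one_zpow_mul_exp_eq] at h
  simp only [mul_one, add_zero] at h
  linarith
end

section
/- For every real y > 0, the modular lambda function satisfies λ(i/y) = 1 − λ(iy); that is, (θ₂(i/y)/θ₃(i/y))⁴ = 1 − (θ₂(iy)/θ₃(iy))⁴. -/
open scoped Real
open Real

noncomputable section

/-- `θ₂(iy) = Σ_{n ∈ ℤ} e^{−π(n+1/2)² y}`. -/
def theta2 (y : ℝ) : ℝ := ∑' n : ℤ, Real.exp (-(π * ((n : ℝ) + 1 / 2) ^ 2 * y))

/-- `θ₃(iy) = Σ_{n ∈ ℤ} e^{−π n² y}`. -/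
def theta3 (y : ℝ) : ℝ := ∑' n : ℤ, Real.exp (-(π * (n : ℝ) ^ 2 * y))

/-- `θ₄(iy) = Σ_{n ∈ ℤ} (-1)ⁿ e^{−π n² y}`. -/
def theta4 (y : ℝ) : ℝ := ∑' n : ℤ, (-1 : ℝ) ^ n * Real.exp (-(π * (n : ℝ) ^ 2 * y))

/-- A product of two sums over `ℤ`, split according to the parity of the sum of the indices. -/
lemma tsum_mul_tsum_eq_add_of_parity {f g : ℤ → ℝ} (hf : Summable fun n => ‖f n‖)
    (hg : Summable fun n => ‖g n‖) :
    (∑' n, f n) * ∑' n, g n = (∑' p : ℤ × ℤ, f (p.1 + p.2) * g (p.1 - p.2)) +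
      ∑' p : ℤ × ℤ, f (p.1 + p.2 + 1) * g (p.1 - p.2) := by
  have hs := summable_mul_of_summable_norm hf hg
  rw [tsum_mul_tsum_of_summable_norm hf hg]
  have he : Function.Injective fun p : ℤ × ℤ => (p.1 + p.2, p.1 - p.2) := by
    rintro ⟨a, b⟩ ⟨c, d⟩ h
    simp only [Prod.mk.injEq] at h ⊢
    omega
  have ho : Function.Injective fun p : ℤ × ℤ => (p.1 + p.2 + 1, p.1 - p.2) := by
    rintro ⟨a, b⟩ ⟨c, d⟩ h
    simp only [Prod.mk.injEq] at h ⊢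
    omega
  refine ((he.hasSum_range_iff.2 (hs.comp_injective he).hasSum).add_isCompl ?_
    (ho.hasSum_range_iff.2 (hs.comp_injective ho).hasSum)).tsum_eq
  rw [isCompl_iff, Set.disjoint_left, codisjoint_iff_le_sup]
  constructor
  · rintro _ ⟨⟨a, b⟩, rfl⟩ ⟨⟨c, d⟩, h⟩
    simp only [Prod.mk.injEq] at h
    omega
  · rintro ⟨m, n⟩ -
    rcases Int.even_or_odd (m + n) with ⟨k, hk⟩ | ⟨k, hk⟩
    · exact Or.inl ⟨(k, m - k), Prod.ext (by grind) (by grind)⟩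
    · exact Or.inr ⟨(k, m - k - 1), Prod.ext (by grind) (by grind)⟩

lemma summable_exp_neg_add_sq (a : ℝ) {y : ℝ} (hy : 0 < y) :
    Summable fun n : ℤ => Real.exp (-(π * ((n : ℝ) + a) ^ 2 * y)) := by
  refine (HurwitzKernelBounds.summable_f_int 0 a hy).congr fun n => ?_
  simp [HurwitzKernelBounds.f_int]

lemma summable_exp_neg_sq {y : ℝ} (hy : 0 < y) :
    Summable fun n : ℤ => Real.exp (-(π * (n : ℝ) ^ 2 * y)) := by
  simpa using summable_exp_neg_add_sq 0 hy

lemma theta2_mul_theta3 {y : ℝ} (hy : 0 < y) : theta2 y * theta3 y =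
    ∑' p : ℤ × ℤ, Real.exp (-(π * ((p.1 : ℝ) + 1 / 2) ^ 2 * y)) *
      Real.exp (-(π * (p.2 : ℝ) ^ 2 * y)) :=
  tsum_mul_tsum_of_summable_norm (summable_exp_neg_add_sq _ hy).norm (summable_exp_neg_sq hy).norm

lemma theta2_sq_double {y : ℝ} (hy : 0 < y) :
    theta2 y ^ 2 = 2 * theta2 (2 * y) * theta3 (2 * y) := by
  have h := (summable_exp_neg_add_sq (1 / 2) hy).norm
  have hy' : 0 < 2 * y := by positivity
  rw [mul_assoc, theta2_mul_theta3 hy', sq, two_mul (tsum _)]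
  rw [theta2, tsum_mul_tsum_eq_add_of_parity h h]
  congr 1
  · refine tsum_congr fun p => ?_
    rw [← Real.exp_add, ← Real.exp_add]
    congr 1
    push_cast
    ring
  · let e : ℤ × ℤ ≃ ℤ × ℤ :=
      ((Equiv.addRight (1 : ℤ)).prodCongr (Equiv.refl ℤ)).trans (Equiv.prodComm ℤ ℤ)
    refine Eq.trans ?_ (e.tsum_eq _)
    refine tsum_congr fun p => ?_
    rw [← Real.exp_add, ← Real.exp_add]
    congr 1
    simp only [e, Equiv.trans_apply, Equiv.prodCongr_apply, Equiv.prodComm_apply,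
      Prod.swap, Prod.map_fst, Prod.map_snd, Equiv.coe_addRight, Equiv.refl_apply]
    push_cast
    ring

lemma theta3_sq_double {y : ℝ} (hy : 0 < y) :
    theta3 y ^ 2 = theta3 (2 * y) ^ 2 + theta2 (2 * y) ^ 2 := by
  have h := (summable_exp_neg_sq hy).norm
  have hy' : 0 < 2 * y := by positivity
  have h3 := (summable_exp_neg_sq hy').norm
  have h2 := (summable_exp_neg_add_sq (1 / 2) hy').norm
  simp only [sq (theta3 _), sq (theta2 _)]
  rw [theta3, theta3, theta2, tsum_mul_tsum_eq_add_of_parity h h,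
    tsum_mul_tsum_of_summable_norm h3 h3, tsum_mul_tsum_of_summable_norm h2 h2]
  simp only [← Real.exp_add]
  congr 1 <;>
  · refine tsum_congr fun p => ?_
    push_cast
    ring_nf

lemma theta4_sq_double {y : ℝ} (hy : 0 < y) :
    theta4 y ^ 2 = theta3 (2 * y) ^ 2 - theta2 (2 * y) ^ 2 := by
  have h : Summable fun n : ℤ => ‖(-1 : ℝ) ^ n * Real.exp (-(π * (n : ℝ) ^ 2 * y))‖ := by
    simpa [norm_zpow] using summable_exp_neg_sq hy
  have hy' : 0 < 2 * y := by positivity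
  have h3 := (summable_exp_neg_sq hy').norm
  have h2 := (summable_exp_neg_add_sq (1 / 2) hy').norm
  simp only [sq (theta3 _), sq (theta2 _), sq (theta4 _)]
  rw [theta4, theta3, theta2, tsum_mul_tsum_eq_add_of_parity h h,
    tsum_mul_tsum_of_summable_norm h3 h3, tsum_mul_tsum_of_summable_norm h2 h2, sub_eq_add_neg,
    ← tsum_neg]
  have hs (a b : ℤ) (u v : ℝ) : (-1 : ℝ) ^ (a + b) * u * ((-1) ^ (a - b) * v) = u * v := by
    have : (-1 : ℝ) ^ (a + b) * (-1) ^ (a - b) = 1 := by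
      rw [← zpow_add₀ (by norm_num)]
      exact Even.neg_one_zpow ⟨a, by ring⟩
    linear_combination u * v * this
  have hs' (a b : ℤ) (u v : ℝ) :
      (-1 : ℝ) ^ (a + b + 1) * u * ((-1) ^ (a - b) * v) = -(u * v) := by
    rw [zpow_add_one₀ (by norm_num)]
    linear_combination -hs a b u v
  simp only [hs, hs', ← Real.exp_add]
  congr 1 <;>
  · refine tsum_congr fun p => ?_
    push_cast
    ring_nf

/-- Jacobi's identity `θ₃⁴ = θ₂⁴ + θ₄⁴`. -/
lemma theta3_pow_four {y : ℝ} (hy : 0 < y) : theta3 y ^ 4 = theta2 y ^ 4 + theta4 y ^ 4 := by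
  have h2 := theta2_sq_double hy
  have h3 := theta3_sq_double hy
  have h4 := theta4_sq_double hy
  rw [show theta3 y ^ 4 = (theta3 y ^ 2) ^ 2 by ring,
    show theta2 y ^ 4 = (theta2 y ^ 2) ^ 2 by ring,
    show theta4 y ^ 4 = (theta4 y ^ 2) ^ 2 by ring, h2, h3, h4]
  ring

lemma theta3_inv {y : ℝ} (hy : 0 < y) : theta3 y = 1 / y ^ (1 / 2 : ℝ) * theta3 (1 / y) := by
  have h := Real.tsum_exp_neg_mul_int_sq hy
  unfold theta3
  convert h using 6 <;> ring_nf

lemma theta4_inv {y : ℝ} (hy : 0 < y) : theta4 y = 1 / y ^ (1 / 2 : ℝ) * theta2 (1 / y) := by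
  have h := Complex.tsum_exp_neg_quadratic (by rwa [Complex.ofReal_re] : 0 < (y : ℂ).re)
    (-Complex.I / 2)
  unfold theta4 theta2
  rw [← Complex.ofReal_inj]
  push_cast [Complex.ofReal_tsum, Complex.ofReal_cpow hy.le]
  convert h using 4 with n n
  · rw [add_comm, Complex.exp_add]
    congr 1
    · rw [show 2 * (π : ℂ) * (-Complex.I / 2) * n = n * (-(π * Complex.I)) by ring,
        Complex.exp_int_mul, Complex.exp_neg, Complex.exp_pi_mul_I]
      norm_num
    · ring_nf
  · congr 1
    linear_combination (-π / y * (n + 1/2 + (n - Complex.I ^ 2 / 2)) / 2 : ℂ) * Complex.I_sq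

theorem lambda_inversion (y : ℝ) (hy : 0 < y) :
    (theta2 (1 / y) / theta3 (1 / y)) ^ 4 = 1 - (theta2 y / theta3 y) ^ 4 := by
  have hpos : 0 < theta3 y :=
    (summable_exp_neg_sq hy).tsum_pos (fun _ => (Real.exp_pos _).le) 0 (Real.exp_pos _)
  have hc : (1 / y ^ (1 / 2 : ℝ)) ≠ 0 := by positivity
  have hq : theta2 (1 / y) / theta3 (1 / y) = theta4 y / theta3 y := by
    rw [theta4_inv hy, theta3_inv hy, mul_div_mul_left _ _ hc]
  rw [hq, div_pow, div_pow, eq_sub_iff_add_eq, ← add_div, add_comm, ← theta3_pow_four hy,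
    div_self (by positivity)]
end
end
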